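/- Let the coefficients, defined for all t ∈ ℝ by setting q_{ij}(t,·) = q_{ij}(0,·) and b_i(t,·) = b_i(0,·) for t < 0, satisfy Hypotheses (H) with [0,+∞) replaced by ℝ, let G(t,s) (t ≥ s in ℝ) be the associated evolution operator, and let {μ_t : t ∈ ℝ} be a tight evolution system of measures for G(t,s). Let ν be the Borel measure on ℝ^{1+d} determined by ν(A×B) = ∫_A μ_s(B) ds for Borel sets A ⊆ ℝ and B ⊆ ℝ^d, and define the evolution semigroup (𝒯(t)h)(s,x) = (G(s,s−t)h(s−t,·))(x) for t ≥ 0. Then for every p ∈ [2,+∞) and every continuous compactly supported h : ℝ^{1+d} → ℝ, the quantity ∫_{ℝ^{1+d}} |∇_x (𝒯(t)h)(s,x)|^p dν(s,x) tends to 0 as t → +∞. -/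

import Mathlib

open MeasureTheory Filter Topology Metric Set
open scoped RealInnerProductSpace

noncomputable section

abbrev Ed (d : ℕ) := EuclideanSpace ℝ (Fin d)

/-- `f` belongs to `C_b(ℝ^d)`: it is bounded and continuous. -/
def IsCb {d : ℕ} (f : Ed d → ℝ) : Prop :=
  Continuous f ∧ ∃ M, ∀ x, |f x| ≤ M

/-- The action of the operator `A(t)φ = Tr(Q(t,·)D²φ) + ⟨b(t,·),∇φ⟩`. -/
def applyA {d : ℕ} (q : ℝ → Ed d → Matrix (Fin d) (Fin d) ℝ) (b : ℝ → Ed d → Ed d)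
    (t : ℝ) (u : Ed d → ℝ) (x : Ed d) : ℝ :=
  (∑ i, ∑ j, q t x i j *
      iteratedFDeriv ℝ 2 u x ![EuclideanSpace.single i 1, EuclideanSpace.single j 1]) +
    ⟪b t x, gradient u x⟫

/-- `u` is a bounded classical solution (in `C_b([s,∞)×ℝ^d) ∩ C^{1,2}((s,∞)×ℝ^d)`)
of `D_t u = A(t)u` on `(s,∞)×ℝ^d` with `u(s,·) = f`. -/
structure IsBoundedClassicalSolution {d : ℕ} (q : ℝ → Ed d → Matrix (Fin d) (Fin d) ℝ)
    (b : ℝ → Ed d → Ed d) (s : ℝ) (f : Ed d → ℝ) (u : ℝ → Ed d → ℝ) : Prop where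
  cont : ContinuousOn (fun z : ℝ × Ed d => u z.1 z.2) (Ici s ×ˢ (univ : Set (Ed d)))
  bdd : ∃ M, ∀ t ∈ Ici s, ∀ x, |u t x| ≤ M
  smooth_space : ∀ t ∈ Ioi s, ContDiff ℝ 2 (u t)
  pde : ∀ t ∈ Ioi s, ∀ x, HasDerivAt (fun τ => u τ x) (applyA q b t (u t) x) t
  init : ∀ x, u s x = f x

/-- Hypotheses (H) with `[0,∞)` replaced by `ℝ` (coefficients extended to negative times
by their value at `t = 0`), together with the associated evolution operator `G(t,s)`,
`t ≥ s` in `ℝ`. -/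
structure HypothesesR (d : ℕ) where
  /-- the Hölder exponent -/
  α : ℝ
  hα : α ∈ Ioo (0:ℝ) 1
  /-- the diffusion coefficients -/
  q : ℝ → Ed d → Matrix (Fin d) (Fin d) ℝ
  /-- the drift coefficients -/
  b : ℝ → Ed d → Ed d
  /-- the ellipticity function -/
  η : ℝ → Ed d → ℝ
  η₀ : ℝ
  -- the coefficients are extended to `t < 0` by their value at `t = 0`
  q_ext : ∀ t < (0:ℝ), q t = q 0
  b_ext : ∀ t < (0:ℝ), b t = b 0
  -- (i): local regularity `C^{α/2,1+α}_loc`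
  q_diff : ∀ t : ℝ, ∀ i j, Differentiable ℝ fun x => q t x i j
  b_diff : ∀ t : ℝ, Differentiable ℝ (b t)
  q_locHolder : ∀ i j, ∀ T > (0:ℝ), ∀ R > (0:ℝ), ∃ L : ℝ,
    ∀ t ∈ Icc (-T) T, ∀ s ∈ Icc (-T) T,
      ∀ x ∈ closedBall (0 : Ed d) R, ∀ y ∈ closedBall (0 : Ed d) R,
        |q t x i j - q s y i j| ≤ L * (|t - s| ^ (α/2) + ‖x - y‖ ^ α) ∧
        ‖gradient (fun z => q t z i j) x - gradient (fun z => q s z i j) y‖ ≤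
          L * (|t - s| ^ (α/2) + ‖x - y‖ ^ α)
  b_locHolder : ∀ i, ∀ T > (0:ℝ), ∀ R > (0:ℝ), ∃ L : ℝ,
    ∀ t ∈ Icc (-T) T, ∀ s ∈ Icc (-T) T,
      ∀ x ∈ closedBall (0 : Ed d) R, ∀ y ∈ closedBall (0 : Ed d) R,
        |b t x i - b s y i| ≤ L * (|t - s| ^ (α/2) + ‖x - y‖ ^ α) ∧
        ‖gradient (fun z => b t z i) x - gradient (fun z => b s z i) y‖ ≤
          L * (|t - s| ^ (α/2) + ‖x - y‖ ^ α)
  -- (i): boundedness on `ℝ × B_R` and uniform-in-time `L^p(B_R)` bounds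
  q_bdd : ∀ R > (0:ℝ), ∃ M : ℝ, ∀ t : ℝ, ∀ x ∈ ball (0 : Ed d) R, ∀ i j, |q t x i j| ≤ M
  q_cont : ∀ R > (0:ℝ), ∀ i j, ContinuousOn (fun z : ℝ × Ed d => q z.1 z.2 i j)
    ((univ : Set ℝ) ×ˢ ball (0 : Ed d) R)
  int_bdd : ∃ p : ℝ, (d : ℝ) + 2 < p ∧ ∀ R > (0:ℝ), ∃ M : ℝ, ∀ t : ℝ, ∀ i j : Fin d,
    (∫ x in ball (0 : Ed d) R, ‖gradient (fun z => q t z i j) x‖ ^ p) ≤ M ∧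
    (∫ x in ball (0 : Ed d) R, |b t x j| ^ p) ≤ M
  -- (ii): symmetry and ellipticity
  q_symm : ∀ t : ℝ, ∀ x, (q t x).IsSymm
  hη₀ : 0 < η₀
  η_lb : ∀ t : ℝ, ∀ x, η₀ ≤ η t x
  ellipticity : ∀ t : ℝ, ∀ x, ∀ ξ : Ed d,
    η t x * ‖ξ‖ ^ 2 ≤ ∑ i, ∑ j, q t x i j * ξ i * ξ j
  -- (iii): Lyapunov function
  V : Ed d → ℝ
  V_pos : ∀ x, 0 < V x
  V_C2 : ContDiff ℝ 2 V
  V_tendsto : Tendsto V (comap (fun x : Ed d => ‖x‖) atTop) atTop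
  a : ℝ
  κ : ℝ
  ha : 0 ≤ a
  hκ : 0 < κ
  lyapunov : ∀ t : ℝ, ∀ x, applyA q b t V x ≤ a - κ * V x
  -- (iv): bounds on the space derivatives of the coefficients
  c₀ : ℝ
  r₀ : ℝ
  hc₀ : 0 ≤ c₀
  gradQ_bdd : ∀ t : ℝ, ∀ x,
    Real.sqrt (∑ i, ∑ j, ‖gradient (fun z => q t z i j) x‖ ^ 2) ≤ c₀ * η t x
  b_dissip : ∀ t : ℝ, ∀ x, ∀ ξ : Ed d, ⟪fderiv ℝ (b t) x ξ, ξ⟫ ≤ r₀ * ‖ξ‖ ^ 2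
  -- (v): growth conditions
  growth : ∃ c > (0:ℝ),
    (∀ t : ℝ, ∀ x,
        Real.sqrt (∑ i, ∑ j, (q t x i j) ^ 2) ≤ c * (1 + ‖x‖) * V x ∧
        ⟪b t x, x⟫ ≤ c * (1 + ‖x‖ ^ 2) * V x) ∨
    (∀ t : ℝ, ∀ x, Real.sqrt (∑ i, ∑ j, (q t x i j) ^ 2) ≤ c)
  /-- the evolution operator, for `t ≥ s` in `ℝ` -/
  G : ℝ → ℝ → (Ed d → ℝ) → Ed d → ℝ
  G_sol : ∀ s : ℝ, ∀ f, IsCb f →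
    IsBoundedClassicalSolution q b s f fun t => G t s f
  G_unique : ∀ s : ℝ, ∀ f, IsCb f → ∀ u,
    IsBoundedClassicalSolution q b s f u → ∀ t ∈ Ici s, ∀ x, u t x = G t s f x

/-- `{μ_t : t ∈ ℝ}` is an evolution system of measures for `G(t,s)` on `ℝ`. -/
def IsEvolutionSystemR {d : ℕ} (H : HypothesesR d) (μ : ℝ → Measure (Ed d)) : Prop :=
  (∀ t : ℝ, IsProbabilityMeasure (μ t)) ∧
    ∀ f, IsCb f → ∀ s t : ℝ, s ≤ t → ∫ x, H.G t s f x ∂μ t = ∫ x, f x ∂μ s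

/-- The system `{μ_t : t ∈ ℝ}` is tight. -/
def IsTightSystemR {d : ℕ} (μ : ℝ → Measure (Ed d)) : Prop :=
  ∀ ε > (0:ℝ), ∃ R > (0:ℝ), ∀ t : ℝ, ENNReal.ofReal (1 - ε) ≤ μ t (ball (0 : Ed d) R)


/-! ### Linear algebra: square roots of positive matrices -/

lemma aux_exists_sqrt {d : ℕ} (P : Matrix (Fin d) (Fin d) ℝ) (hP : P.IsSymm) (ρ : ℝ) (hρ : 0 ≤ ρ)
    (h : ∀ ξ : Fin d → ℝ, ρ * ∑ i, ξ i ^ 2 ≤ ∑ i, ∑ j, P i j * ξ i * ξ j) :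
    ∃ σ : Matrix (Fin d) (Fin d) ℝ, (∀ i j, σ i j = σ j i) ∧ σ * σ = P ∧
      ∀ ξ : Fin d → ℝ, Real.sqrt ρ * ∑ i, ξ i ^ 2 ≤ ∑ i, ∑ j, σ i j * ξ i * ξ j := by
  have hH : P.IsHermitian := by
    rw [Matrix.IsHermitian, Matrix.conjTranspose_eq_transpose_of_trivial]; exact hP
  have quad : ∀ (A : Matrix (Fin d) (Fin d) ℝ) (ξ : Fin d → ℝ),
      ∑ i, ∑ j, A i j * ξ i * ξ j = ξ ⬝ᵥ A.mulVec ξ := by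
    intro A ξ
    simp only [dotProduct, Matrix.mulVec, Finset.mul_sum]
    refine Finset.sum_congr rfl fun i _ => Finset.sum_congr rfl fun j _ => by ring
  have hev : ∀ i, ρ ≤ hH.eigenvalues i := by
    intro i
    have h1 := h (hH.eigenvectorBasis i).ofLp
    rw [quad, hH.mulVec_eigenvectorBasis, dotProduct_smul] at h1
    have h2 : (hH.eigenvectorBasis i).ofLp ⬝ᵥ (hH.eigenvectorBasis i).ofLp = 1 := by
      have h3 := hH.eigenvectorBasis.orthonormal.1 i
      have h4 : ‖hH.eigenvectorBasis i‖ ^ 2 = 1 := by rw [h3]; norm_num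
      rw [EuclideanSpace.real_norm_sq_eq] at h4
      rw [← h4]; simp [dotProduct, sq]
    have h5 : ∑ j, (hH.eigenvectorBasis i).ofLp j ^ 2 = 1 := by
      rw [← h2]; simp [dotProduct, sq]
    rw [h2, h5] at h1
    simpa using h1
  set O : Matrix (Fin d) (Fin d) ℝ := (hH.eigenvectorUnitary : Matrix (Fin d) (Fin d) ℝ) with hO
  have hO1 : star O * O = 1 := Unitary.coe_star_mul_self hH.eigenvectorUnitary
  have hO2 : O * star O = 1 := Unitary.coe_mul_star_self hH.eigenvectorUnitary
  have hst : star O = O.transpose := by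
    rw [Matrix.star_eq_conjTranspose, Matrix.conjTranspose_eq_transpose_of_trivial]
  rw [hst] at hO1 hO2
  have hspec : P = O * Matrix.diagonal hH.eigenvalues * O.transpose := by
    have := hH.spectral_theorem
    rw [Unitary.conjStarAlgAut_apply] at this
    rw [← hst]
    exact this
  refine ⟨O * Matrix.diagonal (fun i => Real.sqrt (hH.eigenvalues i)) * O.transpose, ?_, ?_, ?_⟩
  · intro i j
    have : (O * Matrix.diagonal (fun i => Real.sqrt (hH.eigenvalues i)) * O.transpose).transpose =
        O * Matrix.diagonal (fun i => Real.sqrt (hH.eigenvalues i)) * O.transpose := by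
      simp [Matrix.transpose_mul, Matrix.mul_assoc]
    conv_lhs => rw [← this]
    rfl
  · calc _ = O * Matrix.diagonal (fun i => Real.sqrt (hH.eigenvalues i)) * (O.transpose * O) *
          Matrix.diagonal (fun i => Real.sqrt (hH.eigenvalues i)) * O.transpose := by
            simp only [Matrix.mul_assoc]
      _ = P := by
        rw [hO1, Matrix.mul_one, Matrix.mul_assoc O, Matrix.diagonal_mul_diagonal]
        conv_rhs => rw [hspec]
        congr 3
        ext i
        exact Real.mul_self_sqrt (hρ.trans (hev i))
  · intro ξ
    rw [quad]
    set ζ := O.transpose.mulVec ξ with hζ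
    have e1 : ξ ⬝ᵥ (O * Matrix.diagonal (fun i => Real.sqrt (hH.eigenvalues i)) *
        O.transpose).mulVec ξ = ∑ i, Real.sqrt (hH.eigenvalues i) * ζ i ^ 2 := by
      rw [← Matrix.mulVec_mulVec, ← Matrix.mulVec_mulVec, Matrix.dotProduct_mulVec,
        ← Matrix.mulVec_transpose, ← hζ]
      simp only [dotProduct, Matrix.mulVec_diagonal]
      refine Finset.sum_congr rfl fun i _ => by ring
    have e2 : ∑ i, ξ i ^ 2 = ∑ i, ζ i ^ 2 := by
      have : ζ ⬝ᵥ ζ = ξ ⬝ᵥ ξ := by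
        conv_lhs => rw [hζ, Matrix.dotProduct_mulVec, ← Matrix.mulVec_transpose,
          Matrix.transpose_transpose, Matrix.mulVec_mulVec, hO2, Matrix.one_mulVec]
      simp only [dotProduct, ← sq] at this
      exact this.symm
    rw [e1, e2, Finset.mul_sum]
    refine Finset.sum_le_sum fun i _ => ?_
    exact mul_le_mul_of_nonneg_right (Real.sqrt_le_sqrt (hev i)) (sq_nonneg _)

lemma aux_sqrt_lip {d : ℕ} (σ τ : Matrix (Fin d) (Fin d) ℝ) (l : ℝ) (hl : 0 < l)
    (hσ : ∀ i j, σ i j = σ j i) (hτ : ∀ i j, τ i j = τ j i)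
    (h1 : ∀ ξ : Fin d → ℝ, l * ∑ i, ξ i ^ 2 ≤ ∑ i, ∑ j, σ i j * ξ i * ξ j)
    (h2 : ∀ ξ : Fin d → ℝ, l * ∑ i, ξ i ^ 2 ≤ ∑ i, ∑ j, τ i j * ξ i * ξ j) :
    (2 * l) ^ 2 * ∑ k, ∑ i, (σ i k - τ i k) ^ 2 ≤
      ∑ k, ∑ i, ((σ * σ) i k - (τ * τ) i k) ^ 2 := by
  set D : Fin d → Fin d → ℝ := fun i k => σ i k - τ i k with hD
  set S := ∑ k, ∑ i, (D i k) ^ 2 with hS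
  set N := ∑ k, ∑ i, ((σ * σ) i k - (τ * τ) i k) ^ 2 with hN
  have hDs : ∀ i j, D i j = D j i := fun i j => by simp only [hD]; rw [hσ i j, hτ i j]
  have hS0 : 0 ≤ S := Finset.sum_nonneg fun _ _ => Finset.sum_nonneg fun _ _ => sq_nonneg _
  have key : 2 * l * S ≤ ∑ k, ∑ i, D i k * ((σ * σ) i k - (τ * τ) i k) := by
    have a1 : l * S ≤ ∑ k, ∑ i, ∑ j, σ i j * D i k * D j k := by
      rw [hS, Finset.mul_sum]
      exact Finset.sum_le_sum fun k _ => h1 fun i => D i k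
    have a2 : l * S ≤ ∑ k, ∑ i, ∑ j, τ i j * D i k * D j k := by
      rw [hS, Finset.mul_sum]
      exact Finset.sum_le_sum fun k _ => h2 fun i => D i k
    have a3 : ∑ k, ∑ i, D i k * ((σ * σ) i k - (τ * τ) i k) =
        (∑ k, ∑ i, ∑ j, σ i j * D i k * D j k) + ∑ k, ∑ i, ∑ j, τ i j * D i k * D j k := by
      have b1 : ∀ i k, (σ * σ) i k - (τ * τ) i k =
          (∑ j, σ i j * D j k) + ∑ j, D i j * τ j k := by
        intro i k
        simp only [Matrix.mul_apply, hD, ← Finset.sum_add_distrib, ← Finset.sum_sub_distrib]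
        refine Finset.sum_congr rfl fun j _ => by ring
      simp only [b1, mul_add, Finset.sum_add_distrib, Finset.mul_sum]
      congr 1
      · refine Finset.sum_congr rfl fun k _ => Finset.sum_congr rfl fun i _ =>
          Finset.sum_congr rfl fun j _ => by ring
      · rw [Finset.sum_comm]
        refine Finset.sum_congr rfl fun k _ => Finset.sum_congr rfl fun i _ =>
          Finset.sum_congr rfl fun j _ => ?_
        rw [hDs k i, hDs k j, hτ j i]; ring
    rw [a3]; linarith
  have cs : (∑ k, ∑ i, D i k * ((σ * σ) i k - (τ * τ) i k)) ^ 2 ≤ S * N := by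
    have := Finset.sum_mul_sq_le_sq_mul_sq (Finset.univ ×ˢ Finset.univ : Finset (Fin d × Fin d))
      (fun z => D z.2 z.1) (fun z => (σ * σ) z.2 z.1 - (τ * τ) z.2 z.1)
    simpa only [Finset.sum_product] using this
  have hk : (2 * l * S) ^ 2 ≤ S * N := le_trans (pow_le_pow_left₀ (by positivity) key 2) cs
  rcases hS0.eq_or_lt with h0 | h0
  · show (2 * l) ^ 2 * S ≤ N
    rw [← h0, mul_zero]
    exact Finset.sum_nonneg fun _ _ => Finset.sum_nonneg fun _ _ => sq_nonneg _
  · show (2 * l) ^ 2 * S ≤ N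
    have : S * ((2 * l) ^ 2 * S) ≤ S * N := by nlinarith
    exact le_of_mul_le_mul_left this h0

/-- Expansion of the trace against a bilinear form. -/
lemma aux_trace_expand {d : ℕ} (Q σ : Matrix (Fin d) (Fin d) ℝ) (e : Ed d) (m : ℝ)
    (hσ : ∀ i j, σ i j = σ j i)
    (hQ : ∀ i j, Q i j = (σ * σ) i j + m * (e i * e j))
    (B : Ed d →L[ℝ] Ed d →L[ℝ] ℝ) :
    ∑ i, ∑ j, Q i j * B (EuclideanSpace.single i 1) (EuclideanSpace.single j 1) =
      (∑ k, B (WithLp.toLp 2 fun i => σ i k) (WithLp.toLp 2 fun i => σ i k)) + m * B e e := by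
  have expand : ∀ v w : Ed d, B v w =
      ∑ i, ∑ j, v i * w j * B (EuclideanSpace.single i 1) (EuclideanSpace.single j 1) := by
    intro v w
    have hv : ∀ v : Ed d, v = ∑ i, v i • EuclideanSpace.single i (1:ℝ) := by
      intro v
      ext j
      simp [Finset.sum_apply, Pi.single_apply]
    conv_lhs => rw [hv v, hv w]
    simp only [map_sum, map_smul, sum_apply, smul_apply,
      smul_eq_mul, Finset.mul_sum]
    rw [Finset.sum_comm]
    refine Finset.sum_congr rfl fun i _ => Finset.sum_congr rfl fun j _ => by ring
  have h1 : ∑ k, B (WithLp.toLp 2 fun i => σ i k) (WithLp.toLp 2 fun i => σ i k) =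
      ∑ i, ∑ j, (σ * σ) i j * B (EuclideanSpace.single i 1) (EuclideanSpace.single j 1) := by
    rw [Finset.sum_congr rfl fun k _ => expand (WithLp.toLp 2 fun i => σ i k)
      (WithLp.toLp 2 fun i => σ i k), Finset.sum_comm]
    refine Finset.sum_congr rfl fun i _ => ?_
    rw [Finset.sum_comm]
    refine Finset.sum_congr rfl fun j _ => ?_
    rw [Matrix.mul_apply, Finset.sum_mul]
    refine Finset.sum_congr rfl fun k _ => ?_
    rw [hσ k j]
  rw [h1, expand e e, Finset.mul_sum, ← Finset.sum_add_distrib]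
  refine Finset.sum_congr rfl fun i _ => ?_
  rw [Finset.mul_sum, ← Finset.sum_add_distrib]
  refine Finset.sum_congr rfl fun j _ => ?_
  rw [hQ]; ring

/-! ### One-dimensional calculus -/

lemma aux_second_deriv_nonpos {g g' : ℝ → ℝ} {g'' : ℝ} (hmax : IsLocalMax g 0)
    (h1 : ∀ h, HasDerivAt g (g' h) h) (h2 : HasDerivAt g' g'' 0) : g'' ≤ 0 := by
  by_contra hneg
  push Not at hneg
  have hd : deriv g = g' := funext fun h => (h1 h).deriv
  have h0 : g' 0 = 0 := hmax.hasDerivAt_eq_zero (h1 0)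
  have hmin : IsLocalMin g 0 :=
    isLocalMin_of_deriv_deriv_pos (by rw [hd, h2.deriv]; exact hneg) (by rw [hd, h0])
      (h1 0).continuousAt
  have hconst : g =ᶠ[𝓝 0] fun _ => g 0 := by
    filter_upwards [hmax, hmin] with h a b
    exact le_antisymm a b
  have : g' =ᶠ[𝓝 0] fun _ => 0 := by
    have := hconst.deriv
    rw [hd] at this
    simpa using this
  have h3 : HasDerivAt g' 0 0 := (hasDerivAt_const (0:ℝ) (0:ℝ)).congr_of_eventuallyEq this
  linarith [h3.unique h2]

lemma aux_line_deriv {d : ℕ} {U : Ed d → ℝ} (hU : ContDiff ℝ 2 U) (x p : Ed d) (h : ℝ) :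
    HasDerivAt (fun h : ℝ => U (x + h • p)) (fderiv ℝ U (x + h • p) p) h := by
  have h1 : HasDerivAt (fun h : ℝ => x + h • p) p h := by
    simpa using ((hasDerivAt_id h).smul_const p).const_add x
  exact ((hU.differentiable (by norm_num)) (x + h • p)).hasFDerivAt.comp_hasDerivAt h h1

lemma aux_line_deriv2 {d : ℕ} {U : Ed d → ℝ} (hU : ContDiff ℝ 2 U) (x p : Ed d) (h : ℝ) :
    HasDerivAt (fun h : ℝ => fderiv ℝ U (x + h • p) p)
      (fderiv ℝ (fderiv ℝ U) (x + h • p) p p) h := by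
  have h1 : HasDerivAt (fun h : ℝ => x + h • p) p h := by
    simpa using ((hasDerivAt_id h).smul_const p).const_add x
  have hd : Differentiable ℝ (fderiv ℝ U) :=
    (hU.fderiv_right (m := 1) (by norm_num)).differentiable (by norm_num)
  have h2 := (hd (x + h • p)).hasFDerivAt.comp_hasDerivAt h h1
  have := h2.clm_apply (hasDerivAt_const h p)
  simpa using this

/-- First and second order conditions along a line. -/
lemma aux_second_order {d : ℕ} {U W : Ed d → ℝ} (hU : ContDiff ℝ 2 U) (hW : ContDiff ℝ 2 W)
    (x y p q : Ed d) (M β r a c : ℝ)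
    (hmax : IsLocalMax (fun h : ℝ => U (x + h • p) - W (y + h • q) -
      M * (1 - Real.exp (-β * (r + a * h + c * h ^ 2)))) 0) :
    fderiv ℝ U x p - fderiv ℝ W y q = M * β * Real.exp (-β * r) * a ∧
    fderiv ℝ (fderiv ℝ U) x p p - fderiv ℝ (fderiv ℝ W) y q q ≤
      M * β * Real.exp (-β * r) * (2 * c - β * a ^ 2) := by
  have hl : ∀ h : ℝ, HasDerivAt (fun h : ℝ => -β * (r + a * h + c * h ^ 2))
      (-β * (a + c * (2 * h))) h := by
    intro h
    have := ((((hasDerivAt_id h).const_mul a).const_add r).add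
      (((hasDerivAt_pow 2 h)).const_mul c)).const_mul (-β)
    simpa using this
  have h1 : ∀ h : ℝ, HasDerivAt (fun h : ℝ => U (x + h • p) - W (y + h • q) -
      M * (1 - Real.exp (-β * (r + a * h + c * h ^ 2))))
      (fderiv ℝ U (x + h • p) p - fderiv ℝ W (y + h • q) q -
        M * (- (Real.exp (-β * (r + a * h + c * h ^ 2)) * (-β * (a + c * (2 * h)))))) h := by
    intro h
    exact ((aux_line_deriv hU x p h).sub (aux_line_deriv hW y q h)).sub
      (((hl h).exp.const_sub 1).const_mul M)
  have hl2 : HasDerivAt (fun h : ℝ => -β * (a + c * (2 * h))) (-β * (c * 2)) 0 := by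
    have := ((((hasDerivAt_id (0:ℝ)).const_mul 2).const_mul c).const_add a).const_mul (-β)
    simpa using this
  have h2 := ((aux_line_deriv2 hU x p 0).sub (aux_line_deriv2 hW y q 0)).sub
      ((((hl 0).exp.mul hl2).neg).const_mul M)
  have e1 := hmax.hasDerivAt_eq_zero (h1 0)
  have e2 := aux_second_deriv_nonpos hmax h1 h2
  simp only [zero_smul, add_zero, mul_zero, ne_eq, OfNat.ofNat_ne_zero, not_false_eq_true,
    zero_pow] at e1 e2
  constructor
  · linarith
  · nlinarith


/-! ### Consequences of the hypotheses on the coefficients -/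

lemma aux_norm_gradient {d : ℕ} (f : Ed d → ℝ) (x : Ed d) :
    ‖gradient f x‖ = ‖fderiv ℝ f x‖ := by
  unfold gradient; simp

lemma aux_antitone_le {φ φ' : ℝ → ℝ} (h : ∀ s, HasDerivAt φ (φ' s) s) (h0 : ∀ s, φ' s ≤ 0) :
    φ 1 ≤ φ 0 := by
  have : Antitone φ := antitone_of_deriv_nonpos (fun s => (h s).differentiableAt)
    (fun s => by rw [(h s).deriv]; exact h0 s)
  exact this zero_le_one

lemma aux_b_mono {d : ℕ} (H : HypothesesR d) (t : ℝ) (x y : Ed d) :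
    ⟪H.b t x - H.b t y, x - y⟫ ≤ H.r₀ * ‖x - y‖ ^ 2 := by
  have hline : ∀ s : ℝ, HasDerivAt (fun s : ℝ => y + s • (x - y)) (x - y) s := fun s => by
    simpa using ((hasDerivAt_id s).smul_const (x - y)).const_add y
  have h1 : ∀ s : ℝ, HasDerivAt (fun s : ℝ => ⟪H.b t (y + s • (x - y)), x - y⟫ -
      s * (H.r₀ * ‖x - y‖ ^ 2))
      (⟪fderiv ℝ (H.b t) (y + s • (x - y)) (x - y), x - y⟫ - 1 * (H.r₀ * ‖x - y‖ ^ 2)) s := by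
    intro s
    have hb := (H.b_diff t (y + s • (x - y))).hasFDerivAt.comp_hasDerivAt s (hline s)
    have := hb.inner ℝ (hasDerivAt_const s (x - y))
    simp only [inner_zero_right, zero_add] at this
    exact this.sub ((hasDerivAt_id s).mul_const _)
  have := aux_antitone_le h1 (fun s => by
    have := H.b_dissip t (y + s • (x - y)) (x - y); linarith)
  simp only [one_smul, zero_smul, add_zero, add_sub_cancel, zero_mul, one_mul, sub_zero] at this
  rw [inner_sub_left]; linarith

lemma aux_q_deriv {d : ℕ} (H : HypothesesR d) (t : ℝ) (z : Ed d) (i j : Fin d) :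
    ‖fderiv ℝ (fun x => H.q t x i j) z‖ ≤ H.c₀ * H.η t z := by
  refine le_trans ?_ (H.gradQ_bdd t z)
  rw [← aux_norm_gradient]
  apply Real.le_sqrt_of_sq_le
  calc ‖gradient (fun x => H.q t x i j) z‖ ^ 2
      ≤ ∑ j, ‖gradient (fun x => H.q t x i j) z‖ ^ 2 :=
        Finset.single_le_sum (f := fun j => ‖gradient (fun x => H.q t x i j) z‖ ^ 2)
          (fun _ _ => sq_nonneg _) (Finset.mem_univ j)
    _ ≤ _ := Finset.single_le_sum
          (f := fun i => ∑ j, ‖gradient (fun x => H.q t x i j) z‖ ^ 2)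
          (fun _ _ => Finset.sum_nonneg fun _ _ => sq_nonneg _) (Finset.mem_univ i)

/-- logarithmic Lipschitz property of the quadratic form. -/
lemma aux_quad_log {d : ℕ} (H : HypothesesR d) (t : ℝ) (z z' ξ : Ed d) :
    ∑ i, ∑ j, H.q t z' i j * ξ i * ξ j ≤
      Real.exp (d * H.c₀ * ‖z' - z‖) * ∑ i, ∑ j, H.q t z i j * ξ i * ξ j := by
  set g : Ed d → ℝ := fun z => ∑ i, ∑ j, H.q t z i j * ξ i * ξ j with hg
  set g' : Ed d → Ed d →L[ℝ] ℝ := fun z =>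
    ∑ i, ∑ j, (ξ i * ξ j) • fderiv ℝ (fun x => H.q t x i j) z with hg'
  have hd : ∀ z, HasFDerivAt g (g' z) z := by
    intro z
    refine HasFDerivAt.fun_sum fun i _ => HasFDerivAt.fun_sum fun j _ => ?_
    have := (H.q_diff t i j z).hasFDerivAt.mul_const (ξ i * ξ j)
    refine this.congr_of_eventuallyEq (Eventually.of_forall fun w => ?_)
    simp only [mul_assoc]
  have hb : ∀ z v, g' z v ≤ d * H.c₀ * ‖v‖ * g z := by
    intro z v
    have hη : 0 ≤ H.η t z := H.hη₀.le.trans (H.η_lb t z)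
    have hc : 0 ≤ H.c₀ * H.η t z := mul_nonneg H.hc₀ hη
    calc g' z v = ∑ i, ∑ j, (ξ i * ξ j) * fderiv ℝ (fun x => H.q t x i j) z v := by
          simp [hg', sum_apply, smul_apply]
      _ ≤ ∑ i, ∑ j, (|ξ i| * |ξ j|) * (H.c₀ * H.η t z * ‖v‖) := by
          refine Finset.sum_le_sum fun i _ => Finset.sum_le_sum fun j _ => ?_
          refine (le_abs_self _).trans ?_
          rw [abs_mul, abs_mul]
          refine mul_le_mul_of_nonneg_left ?_ (by positivity)
          refine ((fderiv ℝ (fun x => H.q t x i j) z).le_opNorm v).trans ?_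
          exact mul_le_mul_of_nonneg_right (aux_q_deriv H t z i j) (norm_nonneg _)
      _ = (∑ i, |ξ i|) ^ 2 * (H.c₀ * H.η t z * ‖v‖) := by
          rw [sq, Finset.sum_mul_sum, Finset.sum_mul]
          refine Finset.sum_congr rfl fun i _ => ?_
          rw [Finset.sum_mul]
      _ ≤ (d * ‖ξ‖ ^ 2) * (H.c₀ * H.η t z * ‖v‖) := by
          refine mul_le_mul_of_nonneg_right ?_ (by positivity)
          have := sq_sum_le_card_mul_sum_sq (s := (Finset.univ : Finset (Fin d)))
            (f := fun i => |ξ i|)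
          simpa [EuclideanSpace.real_norm_sq_eq] using this
      _ = d * H.c₀ * ‖v‖ * (H.η t z * ‖ξ‖ ^ 2) := by ring
      _ ≤ d * H.c₀ * ‖v‖ * g z := by
          refine mul_le_mul_of_nonneg_left (H.ellipticity t z ξ) ?_
          have := H.hc₀
          positivity
  set K := d * H.c₀ * ‖z' - z‖ with hK
  have hline : ∀ s : ℝ, HasDerivAt (fun s : ℝ => z + s • (z' - z)) (z' - z) s := fun s => by
    simpa using ((hasDerivAt_id s).smul_const (z' - z)).const_add z
  have h1 : ∀ s : ℝ, HasDerivAt (fun s : ℝ => g (z + s • (z' - z)) * Real.exp (-K * s))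
      (g' (z + s • (z' - z)) (z' - z) * Real.exp (-K * s) +
        g (z + s • (z' - z)) * (Real.exp (-K * s) * (-K * 1))) s := by
    intro s
    exact ((hd (z + s • (z' - z))).comp_hasDerivAt s (hline s)).mul
      (((hasDerivAt_id s).const_mul (-K)).exp)
  have := aux_antitone_le h1 (fun s => by
    have := hb (z + s • (z' - z)) (z' - z)
    have := mul_le_mul_of_nonneg_right this (Real.exp_pos (-K * s)).le
    nlinarith)
  simp only [one_smul, zero_smul, add_zero, add_sub_cancel, mul_one, mul_zero, Real.exp_zero]
    at this
  have e : Real.exp K * Real.exp (-K) = 1 := by rw [← Real.exp_add]; simp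
  calc g z' = Real.exp K * (g z' * Real.exp (-K)) := by
        rw [mul_left_comm, e, mul_one]
    _ ≤ Real.exp K * g z := mul_le_mul_of_nonneg_left this (Real.exp_pos K).le

lemma aux_coeff {d : ℕ} (H : HypothesesR d) (R : ℝ) (t : ℝ) (x y : Ed d) (hxy : x ≠ y)
    (hr : ‖x - y‖ ≤ R) :
    ∃ m : ℝ, H.η₀ * Real.exp (-(d * H.c₀ * R)) ≤ m ∧
      (∀ ξ : Ed d, m * ‖ξ‖ ^ 2 ≤ ∑ i, ∑ j, H.q t x i j * ξ i * ξ j) ∧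
      (∀ ξ : Ed d, m * ‖ξ‖ ^ 2 ≤ ∑ i, ∑ j, H.q t y i j * ξ i * ξ j) ∧
      ∀ i j, |H.q t x i j - H.q t y i j| ≤
        H.c₀ * Real.exp (d * H.c₀ * R) * m * ‖x - y‖ := by
  set K := d * H.c₀ * R with hK
  have hdc : (0:ℝ) ≤ d * H.c₀ := mul_nonneg (Nat.cast_nonneg _) H.hc₀
  have hquad0 : ∀ z ξ : Ed d, 0 ≤ ∑ i, ∑ j, H.q t z i j * ξ i * ξ j := fun z ξ =>
    (mul_nonneg (H.hη₀.le.trans (H.η_lb t z)) (sq_nonneg _)).trans (H.ellipticity t z ξ)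
  have hcomp : ∀ z ∈ segment ℝ x y, ∀ w ∈ segment ℝ x y, ∀ ξ : Ed d,
      H.η t z * ‖ξ‖ ^ 2 ≤ Real.exp K * ∑ i, ∑ j, H.q t w i j * ξ i * ξ j := by
    intro z hz w hw ξ
    refine (H.ellipticity t z ξ).trans ((aux_quad_log H t w z ξ).trans ?_)
    refine mul_le_mul_of_nonneg_right (Real.exp_le_exp.2 ?_) (hquad0 w ξ)
    have : ‖z - w‖ ≤ ‖x - y‖ := by
      have hx' : x ∈ closedBall w (dist x y) := by
        rw [mem_closedBall']; exact segment_subset_closedBall_left x y hw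
      have hy' : y ∈ closedBall w (dist x y) := by
        rw [mem_closedBall']; exact segment_subset_closedBall_right x y hw
      have := (convex_closedBall w (dist x y)).segment_subset hx' hy' hz
      rw [mem_closedBall, dist_eq_norm, dist_eq_norm] at this
      exact this
    exact mul_le_mul_of_nonneg_left (this.trans hr) hdc
  have hxs : x ∈ segment ℝ x y := left_mem_segment ℝ x y
  have hys : y ∈ segment ℝ x y := right_mem_segment ℝ x y
  set A := H.η t '' segment ℝ x y with hA
  have hne : A.Nonempty := ⟨_, x, hxs, rfl⟩
  have hnorm : 0 < ‖x - y‖ := norm_pos_iff.2 (sub_ne_zero.2 hxy)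
  have hbdd : BddAbove A := by
    refine ⟨(Real.exp K * ∑ i, ∑ j, H.q t x i j * (x - y) i * (x - y) j) / ‖x - y‖ ^ 2, ?_⟩
    rintro _ ⟨z, hz, rfl⟩
    rw [le_div_iff₀ (by positivity)]
    exact hcomp z hz x hxs (x - y)
  set S := sSup A with hS
  have hηS : ∀ z ∈ segment ℝ x y, H.η t z ≤ S := fun z hz => le_csSup hbdd ⟨z, hz, rfl⟩
  have hE : Real.exp K * Real.exp (-K) = 1 := by rw [← Real.exp_add]; simp
  have hlow : ∀ w ∈ segment ℝ x y, ∀ ξ : Ed d, S * Real.exp (-K) * ‖ξ‖ ^ 2 ≤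
      ∑ i, ∑ j, H.q t w i j * ξ i * ξ j := by
    intro w hw ξ
    rcases eq_or_ne ξ 0 with rfl | hξ
    · simp
    have hξ' : 0 < ‖ξ‖ := norm_pos_iff.2 hξ
    have : S ≤ (Real.exp K * ∑ i, ∑ j, H.q t w i j * ξ i * ξ j) / ‖ξ‖ ^ 2 := by
      refine csSup_le hne ?_
      rintro _ ⟨z, hz, rfl⟩
      rw [le_div_iff₀ (by positivity)]
      exact hcomp z hz w hw ξ
    rw [le_div_iff₀ (by positivity)] at this
    have h2 := mul_le_mul_of_nonneg_right this (Real.exp_pos (-K)).le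
    calc S * Real.exp (-K) * ‖ξ‖ ^ 2 = S * ‖ξ‖ ^ 2 * Real.exp (-K) := by ring
      _ ≤ _ := h2
      _ = (Real.exp K * Real.exp (-K)) * ∑ i, ∑ j, H.q t w i j * ξ i * ξ j := by ring
      _ = _ := by rw [hE, one_mul]
  refine ⟨S * Real.exp (-K), ?_, hlow x hxs, hlow y hys, ?_⟩
  · exact mul_le_mul_of_nonneg_right ((H.η_lb t x).trans (hηS x hxs)) (Real.exp_pos _).le
  · intro i j
    have := (convex_segment (𝕜 := ℝ) x y).norm_image_sub_le_of_norm_fderiv_le (𝕜 := ℝ)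
      (f := fun z => H.q t z i j) (C := H.c₀ * S)
      (fun z _ => H.q_diff t i j z)
      (fun z hz => (aux_q_deriv H t z i j).trans
        (mul_le_mul_of_nonneg_left (hηS z hz) H.hc₀)) hys hxs
    rw [Real.norm_eq_abs] at this
    refine this.trans (le_of_eq ?_)
    calc H.c₀ * S * ‖x - y‖ = H.c₀ * S * ‖x - y‖ * (Real.exp K * Real.exp (-K)) := by
          rw [hE, mul_one]
      _ = _ := by ring


/-! ### The doubling of variables lemma -/

lemma aux_applyA {d : ℕ} (q : ℝ → Ed d → Matrix (Fin d) (Fin d) ℝ) (b : ℝ → Ed d → Ed d)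
    (t : ℝ) (u : Ed d → ℝ) (x : Ed d) :
    applyA q b t u x = (∑ i, ∑ j, q t x i j *
      fderiv ℝ (fderiv ℝ u) x (EuclideanSpace.single i 1) (EuclideanSpace.single j 1)) +
      fderiv ℝ u x (b t x) := by
  unfold applyA
  congr 1
  · refine Finset.sum_congr rfl fun i _ => Finset.sum_congr rfl fun j _ => ?_
    rw [iteratedFDeriv_two_apply]
    rfl
  · rw [real_inner_comm]
    unfold gradient
    rw [InnerProductSpace.toDual_symm_apply]

lemma aux_applyA_sub {d : ℕ} (q : ℝ → Ed d → Matrix (Fin d) (Fin d) ℝ) (b : ℝ → Ed d → Ed d)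
    (t : ℝ) {u v : Ed d → ℝ} (hu : ContDiff ℝ 2 u) (hv : ContDiff ℝ 2 v) (c : ℝ) (x : Ed d) :
    applyA q b t (fun z => u z + c * v z) x = applyA q b t u x + c * applyA q b t v x := by
  have hdu : Differentiable ℝ u := hu.differentiable (by norm_num)
  have hdv : Differentiable ℝ v := hv.differentiable (by norm_num)
  have hdu2 : Differentiable ℝ (fderiv ℝ u) :=
    (hu.fderiv_right (m := 1) (by norm_num)).differentiable (by norm_num)
  have hdv2 : Differentiable ℝ (fderiv ℝ v) :=
    (hv.fderiv_right (m := 1) (by norm_num)).differentiable (by norm_num)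
  have h1 : fderiv ℝ (fun z => u z + c * v z) = fun z => fderiv ℝ u z + c • fderiv ℝ v z := by
    ext1 z
    exact ((hdu z).hasFDerivAt.add ((hdv z).hasFDerivAt.const_mul c)).fderiv
  have h2 : fderiv ℝ (fun z => fderiv ℝ u z + c • fderiv ℝ v z) x =
      fderiv ℝ (fderiv ℝ u) x + c • fderiv ℝ (fderiv ℝ v) x :=
    ((hdu2 x).hasFDerivAt.add ((hdv2 x).hasFDerivAt.const_smul c)).fderiv
  rw [aux_applyA, aux_applyA, aux_applyA, h1, h2, mul_add, Finset.mul_sum]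
  simp only [add_apply, smul_apply, smul_eq_mul]
  have : ∀ a b c' e : ℝ, a + b + (c' + e) = (a + c') + (b + e) := fun _ _ _ _ => by ring
  rw [this, ← Finset.sum_add_distrib]
  congr 1
  refine Finset.sum_congr rfl fun i _ => ?_
  rw [Finset.mul_sum, ← Finset.sum_add_distrib]
  refine Finset.sum_congr rfl fun j _ => by ring

/-- First and second order conditions at a maximum of
`U(x) - W(y) - M (1 - exp(-β |x-y|))`. -/
lemma aux_dir {d : ℕ} {U W : Ed d → ℝ} (hU : ContDiff ℝ 2 U) (hW : ContDiff ℝ 2 W)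
    (M β : ℝ) (hM : 0 ≤ M) (hβ : 0 ≤ β) (x y : Ed d)
    (hmax : IsLocalMax (fun z : Ed d × Ed d => U z.1 - W z.2 -
      M * (1 - Real.exp (-β * ‖z.1 - z.2‖))) (x, y)) (p q : Ed d) (a c : ℝ)
    (hle : ∀ᶠ h : ℝ in 𝓝 0, ‖(x + h • p) - (y + h • q)‖ ≤ ‖x - y‖ + a * h + c * h ^ 2) :
    fderiv ℝ U x p - fderiv ℝ W y q = M * β * Real.exp (-β * ‖x - y‖) * a ∧
    fderiv ℝ (fderiv ℝ U) x p p - fderiv ℝ (fderiv ℝ W) y q q ≤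
      M * β * Real.exp (-β * ‖x - y‖) * (2 * c - β * a ^ 2) := by
  refine aux_second_order hU hW x y p q M β ‖x - y‖ a c ?_
  have hc : Tendsto (fun h : ℝ => (x + h • p, y + h • q)) (𝓝 0) (𝓝 (x, y)) := by
    have : Continuous (fun h : ℝ => (x + h • p, y + h • q)) := by fun_prop
    simpa using this.tendsto 0
  have := hc.eventually hmax
  filter_upwards [this, hle] with h h1 h2
  simp only [zero_smul, add_zero, mul_zero, ne_eq, OfNat.ofNat_ne_zero, not_false_eq_true,
    zero_pow]
  refine le_trans ?_ h1
  have : Real.exp (-β * (‖x - y‖ + a * h + c * h ^ 2)) ≤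
      Real.exp (-β * ‖(x + h • p) - (y + h • q)‖) := by
    apply Real.exp_le_exp.2; nlinarith
  nlinarith

lemma aux_norm_line {d : ℕ} (ξ δ : Ed d) (hξ : 0 < ‖ξ‖) (h : ℝ) :
    ‖ξ + h • δ‖ ≤ ‖ξ‖ + (⟪ξ, δ⟫ / ‖ξ‖) * h + (‖δ‖ ^ 2 / (2 * ‖ξ‖)) * h ^ 2 := by
  have h1 : ‖ξ + h • δ‖ ^ 2 = ‖ξ‖ ^ 2 + 2 * (h * ⟪ξ, δ⟫) + h ^ 2 * ‖δ‖ ^ 2 := by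
    rw [norm_add_sq_real, inner_smul_right, norm_smul, mul_pow, Real.norm_eq_abs, sq_abs]
  have h2 : ‖ξ + h • δ‖ ≤ (‖ξ + h • δ‖ ^ 2 + ‖ξ‖ ^ 2) / (2 * ‖ξ‖) := by
    rw [le_div_iff₀ (by positivity)]
    nlinarith [sq_nonneg (‖ξ + h • δ‖ - ‖ξ‖)]
  refine h2.trans (le_of_eq ?_)
  rw [h1]
  field_simp
  ring

set_option maxHeartbeats 1000000 in
/-- The doubling of variables lemma with the reflection coupling. -/
lemma aux_doubling {d : ℕ} (H : HypothesesR d) (R : ℝ) (hR : 0 < R) :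
    ∃ β > (0:ℝ), ∃ c > (0:ℝ), ∀ (t : ℝ) (U W : Ed d → ℝ), ContDiff ℝ 2 U → ContDiff ℝ 2 W →
      ∀ M : ℝ, 0 ≤ M → ∀ x y : Ed d, 0 < ‖x - y‖ → ‖x - y‖ < R →
      IsLocalMax (fun z : Ed d × Ed d => U z.1 - W z.2 -
        M * (1 - Real.exp (-β * ‖z.1 - z.2‖))) (x, y) →
      applyA H.q H.b t U x - applyA H.q H.b t W y ≤ - M * c := by
  set m0 := H.η₀ * Real.exp (-(d * H.c₀ * R)) with hm0
  have hm0p : 0 < m0 := mul_pos H.hη₀ (Real.exp_pos _)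
  set C := (d:ℝ) ^ 2 * (H.c₀ * Real.exp (d * H.c₀ * R)) ^ 2 with hC
  have hC0 : 0 ≤ C := by positivity
  set β := 1 + C * R + |H.r₀| * R / m0 with hβ
  have hβ0 : 0 < β := by positivity
  refine ⟨β, hβ0, β * Real.exp (-β * R) * m0, by positivity, ?_⟩
  intro t U W hU hW M hM x y hr hrR hmax
  set r := ‖x - y‖ with hrdef
  have hxy : x ≠ y := by
    rintro rfl; simp [hrdef] at hr
  obtain ⟨m, hm, hQx, hQy, hQd⟩ := aux_coeff H R t x y hxy hrR.le
  have hmp : 0 < m := hm0p.trans_le hm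
  set e : Ed d := r⁻¹ • (x - y) with he
  have hen : ‖e‖ = 1 := by
    rw [he, norm_smul, Real.norm_eq_abs, abs_of_pos (inv_pos.2 hr), ← hrdef,
      inv_mul_cancel₀ hr.ne']
  have hre : r • e = x - y := by rw [he, smul_smul, mul_inv_cancel₀ hr.ne', one_smul]
  set E := M * β * Real.exp (-β * r) with hEdef
  have hE0 : 0 ≤ E := by positivity
  -- the square roots
  have hroot : ∀ z : Ed d, (∀ ξ : Ed d, m * ‖ξ‖ ^ 2 ≤ ∑ i, ∑ j, H.q t z i j * ξ i * ξ j) →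
      ∃ σ : Matrix (Fin d) (Fin d) ℝ, (∀ i j, σ i j = σ j i) ∧
        (∀ i j, H.q t z i j = (σ * σ) i j + (m / 2) * (e i * e j)) ∧
        ∀ ξ : Fin d → ℝ, Real.sqrt (m / 2) * ∑ i, ξ i ^ 2 ≤ ∑ i, ∑ j, σ i j * ξ i * ξ j := by
    intro z hz
    have hs : ∀ i j, H.q t z i j = H.q t z j i := fun i j => (H.q_symm t z).apply j i
    obtain ⟨σ, h1, h2, h3⟩ := aux_exists_sqrt
      (Matrix.of fun i j => H.q t z i j - (m / 2) * (e i * e j))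
      (by
        ext i j
        simp only [Matrix.transpose_apply, Matrix.of_apply]
        rw [hs j i]; ring) (m / 2) (by positivity)
      (by
        intro ξ
        have h1 := hz (WithLp.toLp 2 ξ)
        rw [EuclideanSpace.real_norm_sq_eq] at h1
        have h2 : ∑ i, ∑ j, (Matrix.of fun i j => H.q t z i j - (m / 2) * (e i * e j)) i j *
            ξ i * ξ j = (∑ i, ∑ j, H.q t z i j * ξ i * ξ j) - (m / 2) * (∑ i, e i * ξ i) ^ 2 := by
          rw [sq, Finset.sum_mul_sum, Finset.mul_sum, ← Finset.sum_sub_distrib]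
          refine Finset.sum_congr rfl fun i _ => ?_
          rw [Finset.mul_sum, ← Finset.sum_sub_distrib]
          refine Finset.sum_congr rfl fun j _ => ?_
          simp only [Matrix.of_apply]; ring
        have h3 := Finset.sum_mul_sq_le_sq_mul_sq Finset.univ (fun i => e i) ξ
        have h4 : ∑ i, e i ^ 2 = 1 := by
          rw [← EuclideanSpace.real_norm_sq_eq, hen]; norm_num
        rw [h4, one_mul] at h3
        rw [h2]
        have h5 : m * ∑ i, ξ i ^ 2 ≤ ∑ i, ∑ j, H.q t z i j * ξ i * ξ j := h1
        nlinarith)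
    refine ⟨σ, h1, fun i j => ?_, h3⟩
    rw [h2]; simp
  obtain ⟨σ, hσ1, hσ2, hσ3⟩ := hroot x hQx
  obtain ⟨τ, hτ1, hτ2, hτ3⟩ := hroot y hQy
  have hD : ∑ k, ∑ i, (σ i k - τ i k) ^ 2 ≤ C * m * r ^ 2 := by
    have h1 := aux_sqrt_lip σ τ (Real.sqrt (m / 2)) (Real.sqrt_pos.2 (by positivity))
      hσ1 hτ1 hσ3 hτ3
    have h2 : (2 * Real.sqrt (m / 2)) ^ 2 = 2 * m := by
      rw [mul_pow, Real.sq_sqrt (by positivity)]; ring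
    rw [h2] at h1
    have h3 : ∑ k, ∑ i, ((σ * σ) i k - (τ * τ) i k) ^ 2 ≤
        ∑ k : Fin d, ∑ i : Fin d, (H.c₀ * Real.exp (d * H.c₀ * R) * m * r) ^ 2 := by
      refine Finset.sum_le_sum fun k _ => Finset.sum_le_sum fun i _ => ?_
      have h4 : (σ * σ) i k - (τ * τ) i k = H.q t x i k - H.q t y i k := by
        rw [hσ2, hτ2]; ring
      rw [h4]
      exact sq_le_sq' (abs_le.1 (hQd i k)).1 (abs_le.1 (hQd i k)).2
    simp only [Finset.sum_const, Finset.card_univ, Fintype.card_fin, nsmul_eq_mul] at h3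
    have h5 : (d:ℝ) * (d * (H.c₀ * Real.exp (d * H.c₀ * R) * m * r) ^ 2) =
        m * (C * m * r ^ 2) := by rw [hC]; ring
    rw [h5] at h3
    have h6 := h1.trans h3
    have h7 : 0 ≤ ∑ k, ∑ i, (σ i k - τ i k) ^ 2 :=
      Finset.sum_nonneg fun _ _ => Finset.sum_nonneg fun _ _ => sq_nonneg _
    have h8 : m * ∑ k, ∑ i, (σ i k - τ i k) ^ 2 ≤ m * (C * m * r ^ 2) := by
      have := mul_nonneg hmp.le h7
      linarith
    exact le_of_mul_le_mul_left h8 hmp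
  -- directional conditions
  have hgen : ∀ p q : Ed d, fderiv ℝ U x p - fderiv ℝ W y q = E * (⟪x - y, p - q⟫ / r) ∧
      fderiv ℝ (fderiv ℝ U) x p p - fderiv ℝ (fderiv ℝ W) y q q ≤ E * (‖p - q‖ ^ 2 / r) := by
    intro p q
    have := aux_dir hU hW M β hM hβ0.le x y hmax p q (⟪x - y, p - q⟫ / r)
      (‖p - q‖ ^ 2 / (2 * r)) (Eventually.of_forall fun h => by
        have h1 := aux_norm_line (x - y) (p - q) hr h
        have h2 : (x + h • p) - (y + h • q) = (x - y) + h • (p - q) := by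
          rw [smul_sub]; abel
        rw [h2]; exact h1)
    refine ⟨this.1, this.2.trans ?_⟩
    refine mul_le_mul_of_nonneg_left ?_ hE0
    have h3 : 2 * (‖p - q‖ ^ 2 / (2 * r)) = ‖p - q‖ ^ 2 / r := by field_simp
    rw [h3]
    have : 0 ≤ β * (⟪x - y, p - q⟫ / r) ^ 2 := by positivity
    linarith
  have hrefl : fderiv ℝ (fderiv ℝ U) x e e - fderiv ℝ (fderiv ℝ W) y e e ≤ E * (-4 * β) := by
    have := aux_dir hU hW M β hM hβ0.le x y hmax e (-e) 2 0 (by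
      have hev : ∀ᶠ h : ℝ in 𝓝 0, -(r / 2) < h := lt_mem_nhds (by linarith)
      filter_upwards [hev] with h hh
      have h2 : (x + h • e) - (y + h • -e) = (r + 2 * h) • e := by
        rw [add_smul, hre, smul_neg, mul_smul, two_smul]; abel
      rw [h2, norm_smul, hen, mul_one, Real.norm_eq_abs, abs_of_pos (by linarith)]
      linarith)
    have h2 := this.2
    simp only [map_neg, neg_apply, neg_neg] at h2
    refine h2.trans (le_of_eq ?_)
    rw [hEdef]; ring
  -- summing up
  rw [aux_applyA, aux_applyA, aux_trace_expand _ σ e (m / 2) hσ1 hσ2,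
    aux_trace_expand _ τ e (m / 2) hτ1 hτ2]
  have hsync : (∑ k, fderiv ℝ (fderiv ℝ U) x (WithLp.toLp 2 fun i => σ i k)
        (WithLp.toLp 2 fun i => σ i k)) -
      (∑ k, fderiv ℝ (fderiv ℝ W) y (WithLp.toLp 2 fun i => τ i k)
        (WithLp.toLp 2 fun i => τ i k)) ≤ E * (C * m * r) := by
    rw [← Finset.sum_sub_distrib]
    calc _ ≤ ∑ k, E * ((∑ i, (σ i k - τ i k) ^ 2) / r) := by
          refine Finset.sum_le_sum fun k _ => ?_
          refine (hgen _ _).2.trans (le_of_eq ?_)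
          rw [EuclideanSpace.real_norm_sq_eq]
          rfl
      _ = E * ((∑ k, ∑ i, (σ i k - τ i k) ^ 2) / r) := by
          rw [← Finset.mul_sum, Finset.sum_div]
      _ ≤ _ := by
          refine mul_le_mul_of_nonneg_left ?_ hE0
          rw [div_le_iff₀ hr]
          exact hD.trans (le_of_eq (by ring))
  have hdrift : fderiv ℝ U x (H.b t x) - fderiv ℝ W y (H.b t y) ≤ E * (|H.r₀| * R / m0 * m) := by
    rw [(hgen _ _).1]
    refine mul_le_mul_of_nonneg_left ?_ hE0
    rw [div_le_iff₀ hr, real_inner_comm]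
    refine (aux_b_mono H t x y).trans ?_
    rw [← hrdef]
    have h1 : H.r₀ * r ^ 2 ≤ |H.r₀| * R * r := by
      have := le_abs_self H.r₀
      have h3 : H.r₀ * r ^ 2 ≤ |H.r₀| * r ^ 2 := mul_le_mul_of_nonneg_right this (sq_nonneg _)
      have h4 : |H.r₀| * r ^ 2 ≤ |H.r₀| * (R * r) :=
        mul_le_mul_of_nonneg_left
          (by rw [sq]; exact mul_le_mul_of_nonneg_right hrR.le hr.le) (abs_nonneg _)
      linarith
    have h2 : 1 ≤ m / m0 := (one_le_div hm0p).2 hm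
    calc H.r₀ * r ^ 2 ≤ |H.r₀| * R * r := h1
      _ ≤ (|H.r₀| * R * r) * (m / m0) := le_mul_of_one_le_right (by positivity) h2
      _ = _ := by ring
  have hfin : E * (C * m * r) + (m / 2) * (E * (-4 * β)) + E * (|H.r₀| * R / m0 * m) ≤
      - (E * m) := by
    have h1 : C * m * r ≤ C * m * R := mul_le_mul_of_nonneg_left hrR.le (by positivity)
    have h2 : C * m * r + |H.r₀| * R / m0 * m - 2 * m * β ≤ - m := by
      have : β * m = m + C * m * R + |H.r₀| * R / m0 * m := by rw [hβ]; ring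
      have : 0 < β * m := by positivity
      linarith
    have := mul_le_mul_of_nonneg_left h2 hE0
    linarith
  have hlast : M * (β * Real.exp (-β * R) * m0) ≤ E * m := by
    rw [hEdef]
    have h1 : Real.exp (-β * R) ≤ Real.exp (-β * r) := by
      apply Real.exp_le_exp.2
      have := mul_le_mul_of_nonneg_left hrR.le hβ0.le
      linarith
    calc M * (β * Real.exp (-β * R) * m0) = M * β * Real.exp (-β * R) * m0 := by ring
      _ ≤ M * β * Real.exp (-β * r) * m := by gcongr
  have := mul_le_mul_of_nonneg_left hrefl (half_pos hmp).le
  linarith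

/-- The plain maximum principle at a maximum point. -/
lemma aux_max_point {d : ℕ} (H : HypothesesR d) (t : ℝ) (U W : Ed d → ℝ) (hU : ContDiff ℝ 2 U)
    (hW : ContDiff ℝ 2 W) (x y : Ed d)
    (hmax : IsLocalMax (fun z : Ed d × Ed d => U z.1 - W z.2) (x, y)) :
    applyA H.q H.b t U x - applyA H.q H.b t W y ≤ 0 := by
  have hroot : ∀ z : Ed d, 
      ∃ σ : Matrix (Fin d) (Fin d) ℝ, (∀ i j, σ i j = σ j i) ∧
        (∀ i j, H.q t z i j = (σ * σ) i j + 0 * ((0 : Ed d) i * (0 : Ed d) j)) := by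
    intro z
    obtain ⟨σ, h1, h2, h3⟩ := aux_exists_sqrt (H.q t z) (H.q_symm t z) 0 le_rfl
      (by
        intro ξ
        rw [zero_mul]
        refine le_trans ?_ (H.ellipticity t z (WithLp.toLp 2 ξ))
        exact mul_nonneg (H.hη₀.le.trans (H.η_lb t z)) (sq_nonneg _))
    exact ⟨σ, h1, fun i j => by rw [h2]; simp⟩
  obtain ⟨σ, hσ1, hσ2⟩ := hroot x
  obtain ⟨τ, hτ1, hτ2⟩ := hroot y
  have hgen : ∀ p q : Ed d, fderiv ℝ U x p - fderiv ℝ W y q = 0 ∧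
      fderiv ℝ (fderiv ℝ U) x p p - fderiv ℝ (fderiv ℝ W) y q q ≤ 0 := by
    intro p q
    have := aux_second_order hU hW x y p q 0 0 0 0 0 (by
      have hc : Tendsto (fun h : ℝ => (x + h • p, y + h • q)) (𝓝 0) (𝓝 (x, y)) := by
        have : Continuous (fun h : ℝ => (x + h • p, y + h • q)) := by fun_prop
        simpa using this.tendsto 0
      filter_upwards [hc.eventually hmax] with h h1
      simpa using h1)
    simpa using this
  rw [aux_applyA, aux_applyA, aux_trace_expand _ σ 0 0 hσ1 hσ2,
    aux_trace_expand _ τ 0 0 hτ1 hτ2]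
  have h1 := (hgen (H.b t x) (H.b t y)).1
  have h2 : (∑ k, fderiv ℝ (fderiv ℝ U) x (WithLp.toLp 2 fun i => σ i k)
        (WithLp.toLp 2 fun i => σ i k)) -
      (∑ k, fderiv ℝ (fderiv ℝ W) y (WithLp.toLp 2 fun i => τ i k)
        (WithLp.toLp 2 fun i => τ i k)) ≤ 0 := by
    rw [← Finset.sum_sub_distrib]
    exact Finset.sum_nonpos fun k _ => (hgen _ _).2
  linarith


/-! ### The comparison principle -/

lemma aux_left_deriv {φ : ℝ → ℝ} {φ' s τ : ℝ} (h : HasDerivAt φ φ' τ) (hs : s < τ)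
    (hle : ∀ σ ∈ Icc s τ, φ σ ≤ φ τ) : 0 ≤ φ' := by
  have h1 : Tendsto (slope φ τ) (𝓝[<] τ) (𝓝 φ') :=
    (hasDerivAt_iff_tendsto_slope.1 h).mono_left
      (nhdsWithin_mono _ fun x hx => ne_of_lt hx)
  refine ge_of_tendsto h1 ?_
  have : Ioo s τ ∈ 𝓝[<] τ := Ioo_mem_nhdsLT hs
  filter_upwards [this] with σ hσ
  rw [slope_def_field]
  exact div_nonneg_of_nonpos (by linarith [hle σ ⟨hσ.1.le, hσ.2.le⟩]) (by linarith [hσ.2])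

/-- The conclusion of `aux_doubling`. -/
def AuxDoubling {d : ℕ} (H : HypothesesR d) (R β c : ℝ) : Prop :=
  ∀ (t : ℝ) (U W : Ed d → ℝ), ContDiff ℝ 2 U → ContDiff ℝ 2 W →
      ∀ M : ℝ, 0 ≤ M → ∀ x y : Ed d, 0 < ‖x - y‖ → ‖x - y‖ < R →
      IsLocalMax (fun z : Ed d × Ed d => U z.1 - W z.2 -
        M * (1 - Real.exp (-β * ‖z.1 - z.2‖))) (x, y) →
      applyA H.q H.b t U x - applyA H.q H.b t W y ≤ - M * c

/-- The barrier, without the exponential factor in time. -/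
def auxF {d : ℕ} (R β M : ℝ) (v1 v2 : Ed d → ℝ) (c0 c1 : ℝ) (τ : ℝ) (x y : Ed d) : ℝ :=
  M * (1 - Real.exp (-β * min ‖x - y‖ R)) + v1 x + v2 y + c0 + c1 * τ

lemma aux_compare {d : ℕ} (H : HypothesesR d) (R β c : ℝ)
    (hβ : 0 < β) (hdoub : AuxDoubling H R β c) (s T : ℝ) (f : Ed d → ℝ) (u : ℝ → Ed d → ℝ)
    (hu : IsBoundedClassicalSolution H.q H.b s f u) (D : Set (Ed d × Ed d)) (hD : IsCompact D)
    (M l : ℝ) (hM : 0 ≤ M) (v1 v2 : Ed d → ℝ) (hv1 : ContDiff ℝ 2 v1) (hv2 : ContDiff ℝ 2 v2)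
    (c0 c1 : ℝ)
    (hyp : ∀ τ ∈ Icc s T, ∀ x y, (x, y) ∈ D →
      Real.exp (-l * (τ - s)) * auxF R β M v1 v2 c0 c1 (τ - s) x y < u τ x - u τ y →
      s < τ ∧ D ∈ 𝓝 (x, y) ∧ x ≠ y ∧
      (‖x - y‖ < R → - M * c + applyA H.q H.b τ v1 x + applyA H.q H.b τ v2 y +
        l * auxF R β M v1 v2 c0 c1 (τ - s) x y - c1 < 0) ∧
      (R ≤ ‖x - y‖ → applyA H.q H.b τ v1 x + applyA H.q H.b τ v2 y +
        l * auxF R β M v1 v2 c0 c1 (τ - s) x y - c1 < 0)) :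
    ∀ τ ∈ Icc s T, ∀ x y, (x, y) ∈ D →
      u τ x - u τ y ≤ Real.exp (-l * (τ - s)) * auxF R β M v1 v2 c0 c1 (τ - s) x y := by
  intro τ₀ hτ₀ x₀ y₀ hD₀
  by_contra hcon
  push Not at hcon
  set z : ℝ × (Ed d × Ed d) → ℝ := fun w => u w.1 w.2.1 - u w.1 w.2.2 -
    Real.exp (-l * (w.1 - s)) * auxF R β M v1 v2 c0 c1 (w.1 - s) w.2.1 w.2.2 with hz
  have hzc : ContinuousOn z (Icc s T ×ˢ D) := by
    have h1 : ContinuousOn (fun w : ℝ × (Ed d × Ed d) => u w.1 w.2.1) (Icc s T ×ˢ D) := by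
      refine hu.cont.comp (f := fun w : ℝ × (Ed d × Ed d) => (w.1, w.2.1)) (by fun_prop) ?_
      rintro ⟨a, b⟩ hab
      exact ⟨hab.1.1, mem_univ _⟩
    have h2 : ContinuousOn (fun w : ℝ × (Ed d × Ed d) => u w.1 w.2.2) (Icc s T ×ˢ D) := by
      refine hu.cont.comp (f := fun w : ℝ × (Ed d × Ed d) => (w.1, w.2.2)) (by fun_prop) ?_
      rintro ⟨a, b⟩ hab
      exact ⟨hab.1.1, mem_univ _⟩
    refine (h1.sub h2).sub (Continuous.continuousOn ?_)
    have := hv1.continuous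
    have := hv2.continuous
    unfold auxF
    fun_prop
  obtain ⟨⟨τ, x, y⟩, hmem, hmax⟩ := (isCompact_Icc.prod hD).exists_isMaxOn
    ⟨(τ₀, (x₀, y₀)), hτ₀, hD₀⟩ hzc
  have hmax' : ∀ σ ∈ Icc s T, ∀ p ∈ D, z (σ, p) ≤ z (τ, (x, y)) :=
    fun σ hσ p hp => hmax (show (σ, p) ∈ Icc s T ×ˢ D from ⟨hσ, hp⟩)
  have hτ : τ ∈ Icc s T := hmem.1
  have hxyD : (x, y) ∈ D := hmem.2
  have hpos : 0 < z (τ, (x, y)) := by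
    refine lt_of_lt_of_le ?_ (hmax' τ₀ hτ₀ _ hD₀)
    simp only [hz]; linarith
  obtain ⟨hsτ, hnhds, hne, hin, hout⟩ := hyp τ hτ x y hxyD (by
    simp only [hz] at hpos; linarith)
  set e := Real.exp (-l * (τ - s)) with he
  have he0 : 0 < e := Real.exp_pos _
  have hUs := hu.smooth_space τ hsτ
  set U : Ed d → ℝ := fun z => u τ z + (-e) * v1 z with hU
  set W : Ed d → ℝ := fun z => u τ z + e * v2 z with hW
  have hUc : ContDiff ℝ 2 U := hUs.add (contDiff_const.mul hv1)
  have hWc : ContDiff ℝ 2 W := hUs.add (contDiff_const.mul hv2)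
  have hAU := aux_applyA_sub H.q H.b τ hUs hv1 (-e) x
  have hAW := aux_applyA_sub H.q H.b τ hUs hv2 e y
  rw [← hU] at hAU
  rw [← hW] at hAW
  -- time derivative
  have htime : 0 ≤ applyA H.q H.b τ (u τ) x - applyA H.q H.b τ (u τ) y -
      (e * (-l * 1) * auxF R β M v1 v2 c0 c1 (τ - s) x y + e * (c1 * 1)) := by
    refine aux_left_deriv (φ := fun σ => z (σ, (x, y))) (s := s) (τ := τ) ?_ hsτ ?_
    · have h1 : HasDerivAt (fun σ : ℝ => Real.exp (-l * (σ - s)))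
          (e * (-l * 1)) τ := (((hasDerivAt_id τ).sub_const s).const_mul (-l)).exp
      have h2 : HasDerivAt (fun σ : ℝ => auxF R β M v1 v2 c0 c1 (σ - s) x y) (c1 * 1) τ := by
        unfold auxF
        exact (((hasDerivAt_id τ).sub_const s).const_mul c1).const_add _
      exact ((hu.pde τ hsτ x).sub (hu.pde τ hsτ y)).sub (h1.mul h2)
    · intro σ hσ
      exact hmax' σ ⟨hσ.1, hσ.2.trans hτ.2⟩ _ hxyD
  have hspace : ∀ p ∈ D, U p.1 - W p.2 - (M * e) * (1 - Real.exp (-β * min ‖p.1 - p.2‖ R)) ≤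
      U x - W y - (M * e) * (1 - Real.exp (-β * min ‖x - y‖ R)) := by
    intro p hp
    have := hmax' τ hτ p hp
    simp only [hz, auxF] at this
    simp only [hU, hW]
    linarith
  rcases lt_or_ge ‖x - y‖ R with hr | hr
  · have hd := hdoub τ U W hUc hWc (M * e) (by positivity) x y
      (norm_pos_iff.2 (sub_ne_zero.2 hne)) hr (by
        have hev : ∀ᶠ p : Ed d × Ed d in 𝓝 (x, y), ‖p.1 - p.2‖ < R := by
          have : Continuous fun p : Ed d × Ed d => ‖p.1 - p.2‖ := by fun_prop
          exact this.continuousAt.eventually_lt continuousAt_const hr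
        filter_upwards [hev, hnhds] with p hp hpD
        have := hspace p hpD
        rw [min_eq_left hp.le, min_eq_left hr.le] at this
        exact this)
    rw [hAU, hAW] at hd
    have := mul_neg_of_pos_of_neg he0 (hin hr)
    linarith
  · have hd := aux_max_point H τ U W hUc hWc x y (by
        filter_upwards [hnhds] with p hpD
        have := hspace p hpD
        rw [min_eq_right hr] at this
        have h2 : Real.exp (-β * R) ≤ Real.exp (-β * min ‖p.1 - p.2‖ R) := by
          apply Real.exp_le_exp.2
          have := mul_le_mul_of_nonneg_left (min_le_right ‖p.1 - p.2‖ R) hβ.le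
          linarith
        have h3 : (M * e) * Real.exp (-β * R) ≤
            (M * e) * Real.exp (-β * min ‖p.1 - p.2‖ R) :=
          mul_le_mul_of_nonneg_left h2 (by positivity)
        linarith)
    rw [hAU, hAW] at hd
    have := mul_neg_of_pos_of_neg he0 (hout hr)
    linarith


/-! ### Comparison with the Lyapunov function -/

/-- The shifted Lyapunov function. -/
def auxV {d : ℕ} (H : HypothesesR d) (x : Ed d) : ℝ := H.V x + 1

lemma auxV_one_le {d : ℕ} (H : HypothesesR d) (x : Ed d) : 1 ≤ auxV H x := by
  unfold auxV; linarith [H.V_pos x]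

lemma auxV_C2 {d : ℕ} (H : HypothesesR d) : ContDiff ℝ 2 (auxV H) := by
  have := H.V_C2.add (contDiff_const (c := (1:ℝ)))
  exact this

lemma aux_applyA_const {d : ℕ} (q : ℝ → Ed d → Matrix (Fin d) (Fin d) ℝ) (b : ℝ → Ed d → Ed d)
    (t : ℝ) (k : ℝ) (x : Ed d) : applyA q b t (fun _ => k) x = 0 := by
  rw [aux_applyA]
  simp

lemma auxV_lyap {d : ℕ} (H : HypothesesR d) (t θ : ℝ) (hθ : 0 ≤ θ) (x : Ed d) :
    applyA H.q H.b t (fun z => θ * auxV H z) x ≤ θ * ((H.a + H.κ) - H.κ * auxV H x) := by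
  have h1 := aux_applyA_sub H.q H.b t (u := fun _ => θ) (v := H.V) contDiff_const H.V_C2 θ x
  have h2 : (fun z => θ * auxV H z) = fun z => θ + θ * H.V z := by
    ext z; unfold auxV; ring
  rw [h2, h1, aux_applyA_const, zero_add]
  refine mul_le_mul_of_nonneg_left ?_ hθ
  have := H.lyapunov t x
  unfold auxV; linarith

lemma auxV_compact {d : ℕ} (H : HypothesesR d) (K : ℝ) :
    IsCompact {z : Ed d × Ed d | auxV H z.1 + auxV H z.2 ≤ K} := by
  have hc := (auxV_C2 H).continuous
  have hev := H.V_tendsto.eventually_gt_atTop K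
  rw [Filter.eventually_comap, ] at hev
  obtain ⟨r, hr⟩ := eventually_atTop.1 hev
  have hb : ∀ x : Ed d, auxV H x ≤ K → ‖x‖ ≤ r := by
    intro x hx
    by_contra h
    push Not at h
    have := hr ‖x‖ h.le x rfl
    unfold auxV at hx
    linarith
  refine IsCompact.of_isClosed_subset ((isCompact_closedBall (0 : Ed d) r).prod
    (isCompact_closedBall (0 : Ed d) r)) (isClosed_le (by fun_prop) continuous_const) ?_
  rintro ⟨x, y⟩ hxy
  simp only [mem_ofPred_eq] at hxy
  have h1 := auxV_one_le H x
  have h2 := auxV_one_le H y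
  exact ⟨by simpa using hb x (by linarith), by simpa using hb y (by linarith)⟩

lemma aux_psi_nonneg {β r : ℝ} (hβ : 0 ≤ β) (hr : 0 ≤ r) : 0 ≤ 1 - Real.exp (-β * r) := by
  have : Real.exp (-β * r) ≤ 1 := Real.exp_le_one_iff.2 (by nlinarith)
  linarith

lemma aux_psi_le_one {β r : ℝ} : 1 - Real.exp (-β * r) ≤ 1 := by
  have := Real.exp_pos (-β * r)
  linarith

lemma aux_psi_le {β r : ℝ} : 1 - Real.exp (-β * r) ≤ β * r := by
  have := Real.add_one_le_exp (-β * r)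
  linarith

lemma aux_psi_pos {β r : ℝ} (hβ : 0 < β) (hr : 0 < r) : 0 < 1 - Real.exp (-β * r) := by
  have : Real.exp (-β * r) < 1 := Real.exp_lt_one_iff.2 (by nlinarith)
  linarith

lemma aux_global {d : ℕ} (H : HypothesesR d) (R β c : ℝ) (hR : 0 ≤ R)
    (hβ : 0 < β) (hdoub : AuxDoubling H R β c) (s T : ℝ) (f : Ed d → ℝ) (u : ℝ → Ed d → ℝ)
    (hu : IsBoundedClassicalSolution H.q H.b s f u)
    (M l θ : ℝ) (hM : 0 ≤ M) (hl : 0 ≤ l) (hθ : 0 < θ) (c0 c1 : ℝ)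
    (hyp : ∀ τ ∈ Icc s T, ∀ x y,
      Real.exp (-l * (τ - s)) * (M * (1 - Real.exp (-β * min ‖x - y‖ R)) +
        θ * (auxV H x + auxV H y) + c0 + c1 * (τ - s)) < u τ x - u τ y →
      s < τ ∧ x ≠ y ∧
      (‖x - y‖ < R → - M * c + θ * (2 * (H.a + H.κ) - H.κ * (auxV H x + auxV H y)) +
        l * (M * (1 - Real.exp (-β * min ‖x - y‖ R)) +
        θ * (auxV H x + auxV H y) + c0 + c1 * (τ - s)) - c1 < 0) ∧
      (R ≤ ‖x - y‖ → θ * (2 * (H.a + H.κ) - H.κ * (auxV H x + auxV H y)) +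
        l * (M * (1 - Real.exp (-β * min ‖x - y‖ R)) +
        θ * (auxV H x + auxV H y) + c0 + c1 * (τ - s)) - c1 < 0)) :
    ∀ τ ∈ Icc s T, ∀ x y,
      u τ x - u τ y ≤ Real.exp (-l * (τ - s)) * (M * (1 - Real.exp (-β * min ‖x - y‖ R)) +
        θ * (auxV H x + auxV H y) + c0 + c1 * (τ - s)) := by
  have hF : ∀ τ x y, auxF R β M (fun z => θ * auxV H z) (fun z => θ * auxV H z) c0 c1 (τ - s) x y
      = M * (1 - Real.exp (-β * min ‖x - y‖ R)) +
        θ * (auxV H x + auxV H y) + c0 + c1 * (τ - s) := by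
    intro τ x y; unfold auxF; ring
  obtain ⟨m, hm⟩ := hu.bdd
  intro τ₀ hτ₀ x₀ y₀
  have hc := (auxV_C2 H).continuous
  have hsT : s ≤ T := hτ₀.1.trans hτ₀.2
  -- the truncation level
  set K := max (auxV H x₀ + auxV H y₀)
    ((Real.exp (l * (T - s)) * (2 * |m|) + |c0| + |c1| * (T - s)) / θ) with hK
  set D := {z : Ed d × Ed d | auxV H z.1 + auxV H z.2 ≤ K} with hD
  have key := aux_compare H R β c hβ hdoub s T f u hu D (auxV_compact H K) M l hM
    (fun z => θ * auxV H z) (fun z => θ * auxV H z) (contDiff_const.mul (auxV_C2 H))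
    (contDiff_const.mul (auxV_C2 H)) c0 c1 ?_ τ₀ hτ₀ x₀ y₀
    (show auxV H x₀ + auxV H y₀ ≤ K from le_max_left _ _)
  · rwa [hF] at key
  intro τ hτ x y hxy hlt
  rw [hF] at hlt ⊢
  obtain ⟨h1, h2, h3, h4⟩ := hyp τ hτ x y hlt
  have L1 := auxV_lyap H τ θ hθ.le x
  have L2 := auxV_lyap H τ θ hθ.le y
  refine ⟨h1, ?_, h2, fun hr => ?_, fun hr => ?_⟩
  · have hSK : auxV H x + auxV H y < K := by
      by_contra hge
      push Not at hge
      have hge' := (le_max_right _ _).trans hge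
      rw [div_le_iff₀ hθ] at hge'
      have hp := aux_psi_nonneg hβ.le (le_min (norm_nonneg (x - y)) hR)
      have hMp := mul_nonneg hM hp
      have a1 : |c1| * (τ - s) ≤ |c1| * (T - s) :=
        mul_le_mul_of_nonneg_left (by linarith [hτ.2]) (abs_nonneg _)
      have a2 : -(|c1| * (τ - s)) ≤ c1 * (τ - s) := by
        have := neg_abs_le c1
        have h0 : 0 ≤ τ - s := by linarith [hτ.1]
        nlinarith
      have a3 := neg_abs_le c0
      have hb : Real.exp (l * (T - s)) * (2 * |m|) ≤
          M * (1 - Real.exp (-β * min ‖x - y‖ R)) +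
          θ * (auxV H x + auxV H y) + c0 + c1 * (τ - s) := by nlinarith
      have hb2 := mul_le_mul_of_nonneg_left hb (Real.exp_pos (-l * (τ - s))).le
      rw [← mul_assoc, ← Real.exp_add] at hb2
      have hex : 1 ≤ Real.exp (-l * (τ - s) + l * (T - s)) := by
        apply Real.one_le_exp
        have := mul_nonneg hl (sub_nonneg.2 hτ.2)
        linarith
      have hw : u τ x - u τ y ≤ 2 * |m| := by
        have e1 := (abs_le.1 (hm τ hτ.1 x)).2
        have e2 := (abs_le.1 (hm τ hτ.1 y)).1
        have := le_abs_self m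
        linarith
      have : 2 * |m| ≤ Real.exp (-l * (τ - s) + l * (T - s)) * (2 * |m|) :=
        le_mul_of_one_le_left (by positivity) hex
      linarith
    have ho : IsOpen {z : Ed d × Ed d | auxV H z.1 + auxV H z.2 < K} :=
      isOpen_lt (by fun_prop) continuous_const
    exact mem_of_superset (ho.mem_nhds hSK) fun z
      (hz : auxV H z.1 + auxV H z.2 < K) => show auxV H z.1 + auxV H z.2 ≤ K from hz.le
  · have := h3 hr; linarith
  · have := h4 hr; linarith

lemma aux_restart {d : ℕ} {q : ℝ → Ed d → Matrix (Fin d) (Fin d) ℝ} {b : ℝ → Ed d → Ed d}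
    {s : ℝ} {f : Ed d → ℝ} {u : ℝ → Ed d → ℝ} (hu : IsBoundedClassicalSolution q b s f u)
    (s' : ℝ) (hs : s ≤ s') : IsBoundedClassicalSolution q b s' (u s') u where
  cont := hu.cont.mono (prod_mono (Ici_subset_Ici.2 hs) subset_rfl)
  bdd := by
    obtain ⟨m, hm⟩ := hu.bdd
    exact ⟨m, fun t ht => hm t (hs.trans ht)⟩
  smooth_space := fun t ht => hu.smooth_space t (lt_of_le_of_lt hs ht)
  pde := fun t ht => hu.pde t (lt_of_le_of_lt hs ht)
  init := fun _ => rfl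

/-- Oscillation bound. -/
lemma aux_osc {d : ℕ} (H : HypothesesR d) (s : ℝ) (f : Ed d → ℝ) (u : ℝ → Ed d → ℝ)
    (hu : IsBoundedClassicalSolution H.q H.b s f u) (B : ℝ) (hB : ∀ x, |f x| ≤ B)
    (τ : ℝ) (hτ : s ≤ τ) (x y : Ed d) : u τ x - u τ y ≤ 2 * B := by
  obtain ⟨β, hβ, c, hc, hd⟩ := aux_doubling H 1 one_pos
  have hB0 : 0 ≤ B := (abs_nonneg _).trans (hB 0)
  have ha : 0 ≤ H.a + H.κ := by linarith [H.ha, H.hκ]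
  have hτs : 0 ≤ τ - s := by linarith
  have main : ∀ ε > 0, u τ x - u τ y ≤ 2 * B +
      ε * (auxV H x + auxV H y + (2 * (H.a + H.κ) + 1) * (τ - s)) := by
    intro ε hε
    have := aux_global H 1 β c zero_le_one hβ hd s τ f u hu 0 0 ε le_rfl le_rfl hε (2 * B)
      (ε * (2 * (H.a + H.κ) + 1)) ?_ τ ⟨hτ, le_rfl⟩ x y
    · simp only [neg_zero, zero_mul, Real.exp_zero, one_mul, zero_add] at this
      nlinarith
    intro σ hσ x y hlt
    simp only [neg_zero, zero_mul, Real.exp_zero, one_mul, zero_add] at hlt ⊢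
    have v1 := auxV_one_le H x
    have v2 := auxV_one_le H y
    have hσs : 0 ≤ σ - s := by linarith [hσ.1]
    have hp1 : 0 < ε * (auxV H x + auxV H y) := by positivity
    have hp2 : 0 ≤ ε * (2 * (H.a + H.κ) + 1) * (σ - s) := by positivity
    have hp3 : 0 ≤ ε * (H.κ * (auxV H x + auxV H y)) := by
      have := H.hκ
      positivity
    refine ⟨?_, ?_, fun _ => by nlinarith, fun _ => by nlinarith⟩
    · rcases hσ.1.lt_or_eq with h | h
      · exact h
      · exfalso
        subst h
        rw [hu.init, hu.init] at hlt
        have := (abs_le.1 (hB x)).2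
        have := (abs_le.1 (hB y)).1
        linarith
    · rintro rfl
      linarith
  refine le_of_forall_pos_lt_add fun δ hδ => ?_
  set N := auxV H x + auxV H y + (2 * (H.a + H.κ) + 1) * (τ - s) with hN
  have hN0 : 0 < N := by
    have v1 := auxV_one_le H x
    have v2 := auxV_one_le H y
    positivity
  have := main (δ / (2 * N)) (by positivity)
  have e : δ / (2 * N) * N = δ / 2 := by field_simp
  rw [e] at this
  linarith


/-- Exponential decay of oscillations. -/
lemma aux_decay {d : ℕ} (H : HypothesesR d) :
    ∃ lam > (0:ℝ), ∃ N > (0:ℝ), ∀ (B s : ℝ) (f : Ed d → ℝ) (u : ℝ → Ed d → ℝ),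
      IsBoundedClassicalSolution H.q H.b s f u → (∀ x, |f x| ≤ B) → ∀ τ, s ≤ τ → ∀ x y,
      u τ x - u τ y ≤ N * (B + 1) * Real.exp (-lam * (τ - s)) * (auxV H x + auxV H y) := by
  have hκ := H.hκ
  set a1 := H.a + H.κ with ha1
  have ha : 0 < a1 := by linarith [H.ha]
  have hev := H.V_tendsto.eventually_gt_atTop ((4 * a1 + 2) / H.κ)
  rw [Filter.eventually_comap] at hev
  obtain ⟨r, hr⟩ := eventually_atTop.1 hev
  set R := max 1 (2 * r) with hR
  have hR1 : 1 ≤ R := le_max_left _ _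
  have hRr : 2 * r ≤ R := le_max_right _ _
  obtain ⟨β, hβ, c, hc, hd⟩ := aux_doubling H R (by linarith)
  set ε := c / (4 * (a1 + 1)) with hε
  have hε0 : 0 < ε := by positivity
  have hεc : ε * (4 * (a1 + 1)) = c := by rw [hε]; field_simp
  set lam := min (H.κ / 2) (min (c / 4) ε) with hlam
  have hlam0 : 0 < lam := by positivity
  have hl1 : lam ≤ H.κ / 2 := min_le_left _ _
  have hl2 : lam ≤ c / 4 := (min_le_right _ _).trans (min_le_left _ _)
  have hl3 : lam ≤ ε := (min_le_right _ _).trans (min_le_right _ _)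
  refine ⟨lam, hlam0, (1 + ε) / ε, by positivity, ?_⟩
  intro B s f u hu hB τ hτ x y
  have hB0 : 0 ≤ B := (abs_nonneg _).trans (hB 0)
  set K := (B + 1) / ε with hK
  have hK0 : 0 < K := by positivity
  have hKε : K * ε = B + 1 := by rw [hK]; field_simp
  have key := aux_global H R β c (by linarith) hβ hd s τ f u hu K lam (K * ε) hK0.le hlam0.le
    (by positivity) 0 0 ?_ τ ⟨hτ, le_rfl⟩ x y
  · refine key.trans ?_
    have v1 := auxV_one_le H x
    have v2 := auxV_one_le H y
    have hp := aux_psi_le_one (β := β) (r := min ‖x - y‖ R)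
    have h1 : K * (1 - Real.exp (-β * min ‖x - y‖ R)) +
        K * ε * (auxV H x + auxV H y) + 0 + 0 * (τ - s) ≤
        K * (1 + ε) * (auxV H x + auxV H y) := by
      have : K * (1 - Real.exp (-β * min ‖x - y‖ R)) ≤ K * (auxV H x + auxV H y) :=
        mul_le_mul_of_nonneg_left (by linarith) hK0.le
      nlinarith
    refine (mul_le_mul_of_nonneg_left h1 (Real.exp_pos _).le).trans (le_of_eq ?_)
    rw [hK]; ring
  intro σ hσ x y hlt
  have v1 := auxV_one_le H x
  have v2 := auxV_one_le H y
  set S := auxV H x + auxV H y with hS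
  set P := 1 - Real.exp (-β * min ‖x - y‖ R) with hP
  have hP0 : 0 ≤ P := aux_psi_nonneg hβ.le (le_min (norm_nonneg _) (by linarith))
  have hP1 : P ≤ 1 := aux_psi_le_one
  have hFpos : 0 < K * P + K * ε * S + 0 + 0 * (σ - s) := by
    have : 0 < K * ε * S := by positivity
    have : 0 ≤ K * P := by positivity
    linarith
  refine ⟨?_, ?_, fun hr1 => ?_, fun hr1 => ?_⟩
  · rcases hσ.1.lt_or_eq with h | h
    · exact h
    · exfalso
      subst h
      rw [hu.init, hu.init, sub_self, mul_zero, Real.exp_zero, one_mul] at hlt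
      have := (abs_le.1 (hB x)).2
      have := (abs_le.1 (hB y)).1
      have : 0 ≤ K * P := by positivity
      rw [hKε] at hlt
      nlinarith
  · rintro rfl
    rw [sub_self] at hlt
    have := mul_pos (Real.exp_pos (-lam * (σ - s))) hFpos
    linarith
  · have e : -K * c + K * ε * (2 * a1 - H.κ * S) +
        lam * (K * P + K * ε * S + 0 + 0 * (σ - s)) - 0 =
        K * (-c + 2 * (ε * a1) + lam * P - (ε * S) * (H.κ - lam)) := by ring
    rw [e]
    apply mul_neg_of_pos_of_neg hK0
    have e1 : 0 ≤ (ε * S) * (H.κ - lam) := mul_nonneg (by positivity) (by linarith)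
    have e2 : lam * P ≤ lam := by nlinarith
    linarith
  · have hSbig : (4 * a1 + 2) / H.κ < S := by
      have hxy : r ≤ ‖x‖ ∨ r ≤ ‖y‖ := by
        by_contra hcon
        push Not at hcon
        have := norm_sub_le x y
        linarith [hcon.1, hcon.2]
      have hVx := H.V_pos x
      have hVy := H.V_pos y
      rcases hxy with h | h
      · have := hr _ h x rfl
        simp only [hS, auxV]; linarith
      · have := hr _ h y rfl
        simp only [hS, auxV]; linarith
    rw [div_lt_iff₀ hκ] at hSbig
    have e : K * ε * (2 * a1 - H.κ * S) +
        lam * (K * P + K * ε * S + 0 + 0 * (σ - s)) - 0 =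
        K * (ε * (2 * a1 - H.κ * S) + lam * P + lam * (ε * S)) := by ring
    rw [e]
    apply mul_neg_of_pos_of_neg hK0
    have e2 : lam * P ≤ ε := by nlinarith
    have e3 : lam * (ε * S) ≤ H.κ / 2 * (ε * S) :=
      mul_le_mul_of_nonneg_right hl1 (by positivity)
    have e4 : ε * (2 * a1 + 1 - S * H.κ / 2) < 0 := mul_neg_of_pos_of_neg hε0 (by linarith)
    nlinarith

/-- Global Lipschitz bound after time one. -/
lemma aux_lip {d : ℕ} (H : HypothesesR d) (B : ℝ) (hB0 : 0 ≤ B) :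
    ∃ C > (0:ℝ), ∀ (s : ℝ) (f : Ed d → ℝ) (u : ℝ → Ed d → ℝ),
      IsBoundedClassicalSolution H.q H.b s f u → (∀ x, |f x| ≤ B) → ∀ t, s + 1 ≤ t → ∀ x y,
      u t x - u t y ≤ C * ‖x - y‖ := by
  have hκ := H.hκ
  set a1 := H.a + H.κ with ha1
  have ha : 0 < a1 := by linarith [H.ha]
  obtain ⟨β, hβ, c, hc, hd⟩ := aux_doubling H 1 one_pos
  have hψ := aux_psi_pos hβ one_pos
  set ψ1 := 1 - Real.exp (-β * 1) with hψ1
  set M := max ((2 * B + 2) / c) (2 * B / ψ1) with hM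
  have hM1 : 2 * B + 2 ≤ M * c := by
    rw [← div_le_iff₀ hc]; exact le_max_left _ _
  have hM2 : 2 * B ≤ M * ψ1 := by
    rw [← div_le_iff₀ hψ]; exact le_max_right _ _
  have hM0 : 0 < M := lt_of_lt_of_le (by positivity) (le_max_left _ _)
  refine ⟨M * β, by positivity, ?_⟩
  intro s f u hu hB t ht x y
  have hu' := aux_restart hu (t - 1) (by linarith)
  have main : ∀ ε > 0, ε ≤ 1 / (2 * a1) → u t x - u t y ≤ M * β * ‖x - y‖ +
      ε * (auxV H x + auxV H y) := by
    intro ε hε hε1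
    rw [le_div_iff₀ (by positivity)] at hε1
    have := aux_global H 1 β c zero_le_one hβ hd (t - 1) t _ u hu' M 0 ε hM0.le le_rfl hε (2 * B)
      (-(2 * B)) ?_ t ⟨by linarith, le_rfl⟩ x y
    · simp only [neg_zero, zero_mul, Real.exp_zero, one_mul, add_zero] at this
      have e : 2 * B + -(2 * B) * (t - (t - 1)) = 0 := by ring
      have e2 : M * (1 - Real.exp (-β * min ‖x - y‖ 1)) ≤ M * β * ‖x - y‖ := by
        rw [mul_assoc]
        refine mul_le_mul_of_nonneg_left (aux_psi_le.trans ?_) hM0.le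
        exact mul_le_mul_of_nonneg_left (min_le_left _ _) hβ.le
      linarith
    intro σ hσ x y hlt
    simp only [neg_zero, zero_mul, Real.exp_zero, one_mul, add_zero] at hlt ⊢
    have v1 := auxV_one_le H x
    have v2 := auxV_one_le H y
    have hp1 : 0 < ε * (auxV H x + auxV H y) := by positivity
    have hp2 : 0 ≤ 2 * B * (1 - (σ - (t - 1))) := mul_nonneg (by positivity) (by linarith [hσ.2])
    have hp3 : 0 ≤ ε * (H.κ * (auxV H x + auxV H y)) := by positivity
    have hosc := aux_osc H s f u hu B hB σ (by linarith [hσ.1]) x y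
    have hMP : 0 ≤ M * (1 - Real.exp (-β * min ‖x - y‖ 1)) :=
      mul_nonneg hM0.le (aux_psi_nonneg hβ.le (le_min (norm_nonneg _) zero_le_one))
    refine ⟨?_, ?_, fun _ => by nlinarith, fun hr => ?_⟩
    · rcases hσ.1.lt_or_eq with h | h
      · exact h
      · exfalso
        rw [← h] at hlt hosc
        rw [sub_self, mul_zero] at hlt
        linarith
    · rintro rfl
      nlinarith
    · exfalso
      rw [min_eq_right hr, ← hψ1] at hlt
      nlinarith
  refine le_of_forall_pos_lt_add fun δ hδ => ?_
  set N := auxV H x + auxV H y with hN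
  have hN0 : 0 < N := by
    have v1 := auxV_one_le H x
    have v2 := auxV_one_le H y
    positivity
  have := main (min (1 / (2 * a1)) (δ / (2 * N))) (by positivity) (min_le_left _ _)
  have e2 : min (1 / (2 * a1)) (δ / (2 * N)) * N ≤ δ / (2 * N) * N :=
    mul_le_mul_of_nonneg_right (min_le_right _ _) hN0.le
  have e : δ / (2 * N) * N = δ / 2 := by field_simp
  rw [e] at e2
  linarith

lemma aux_grad_of_lip {d : ℕ} {g : Ed d → ℝ} {C : ℝ} (hC : 0 ≤ C) (x : Ed d)
    (h : ∀ᶠ y in 𝓝 x, |g y - g x| ≤ C * ‖y - x‖) : ‖gradient g x‖ ≤ C := by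
  rw [aux_norm_gradient]
  exact norm_fderiv_le_of_lip' ℝ hC (by simpa using h)


/-! ### Local bounds -/

lemma aux_b_bdd {d : ℕ} (H : HypothesesR d) (R : ℝ) (hR : 0 < R) :
    ∃ C : ℝ, ∀ (t : ℝ) (x : Ed d), ‖x‖ ≤ R → ‖H.b t x‖ ≤ C := by
  obtain ⟨p, hp, hIntB⟩ := H.int_bdd
  have hp1 : 1 ≤ p := by
    have : (0:ℝ) ≤ d := Nat.cast_nonneg d
    linarith
  obtain ⟨Mb, hMb⟩ := hIntB (R + 2) (by linarith)
  set v0 := volume.real (ball (0 : Ed d) (1/2)) with hv0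
  have hv0p : 0 < v0 := by
    rw [hv0, Measure.real]
    exact ENNReal.toReal_pos (measure_ball_pos _ _ (by norm_num)).ne' measure_ball_lt_top.ne
  set v1 := volume.real (ball (0 : Ed d) (R + 2)) with hv1
  set I := 3 / 2 * (d * (v1 + Mb)) + v1 * (9 / 4 * |H.r₀|) with hI
  refine ⟨max 0 (2 / v0 * I), fun t x0 hx0 => ?_⟩
  rcases eq_or_ne (H.b t x0) 0 with h0 | h0
  · rw [h0, norm_zero]; exact le_max_left _ _
  refine le_trans ?_ (le_max_right _ _)
  set n := ‖H.b t x0‖ with hn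
  have hn0 : 0 < n := norm_pos_iff.2 h0
  set e : Ed d := n⁻¹ • H.b t x0 with he
  have hen : ‖e‖ = 1 := by
    rw [he, norm_smul, Real.norm_eq_abs, abs_of_pos (inv_pos.2 hn0), ← hn, inv_mul_cancel₀ hn0.ne']
  have hbc : Continuous (H.b t) := (H.b_diff t).continuous
  have hbj : ∀ j, Continuous fun y => |H.b t y j| ^ p := fun j =>
    Continuous.rpow_const (by fun_prop) fun _ => Or.inr (by linarith)
  set g : Ed d → ℝ := fun y => 3 / 2 * (∑ j, (1 + |H.b t y j| ^ p)) + 9 / 4 * |H.r₀| with hg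
  have hgc : Continuous g := by
    refine ((continuous_const.mul (continuous_finsetSum _ fun j _ => ?_)).add continuous_const)
    exact continuous_const.add (hbj j)
  have hg0 : ∀ y, 0 ≤ g y := fun y => by
    simp only [hg]
    have : 0 ≤ ∑ j, (1 + |H.b t y j| ^ p) :=
      Finset.sum_nonneg fun j _ => add_nonneg zero_le_one (Real.rpow_nonneg (abs_nonneg _) _)
    positivity
  have hIntOn : ∀ (k : Ed d → ℝ), Continuous k → ∀ r z, IntegrableOn k (ball z r) := fun k hk r z =>
    (hk.continuousOn.integrableOn_compact (isCompact_closedBall z r)).mono_set ball_subset_closedBall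
  have hpt : ∀ y ∈ ball (x0 - e) (1/2), n / 2 ≤ g y := by
    intro y hy
    rw [mem_ball, dist_eq_norm] at hy
    set z := x0 - y with hz
    have hze : ‖z - e‖ ≤ 1 / 2 := by
      have : z - e = -(y - (x0 - e)) := by rw [hz]; abel
      rw [this, norm_neg]; exact hy.le
    have hzn : ‖z‖ ≤ 3 / 2 := by
      have : z = e + (z - e) := by abel
      rw [this]
      refine (norm_add_le _ _).trans ?_
      linarith
    have h1 := aux_b_mono H t x0 y
    rw [inner_sub_left, ← hz] at h1
    have h2 : ⟪H.b t x0, z⟫ = n + ⟪H.b t x0, z - e⟫ := by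
      have h7 : ⟪H.b t x0, e⟫ = n := by
        rw [he, inner_smul_right, real_inner_self_eq_norm_sq, ← hn]
        field_simp
      rw [inner_sub_right (H.b t x0) z e, h7]
      ring
    have h3 : -(n / 2) ≤ ⟪H.b t x0, z - e⟫ := by
      have h := abs_real_inner_le_norm (H.b t x0) (z - e)
      have h' := (abs_le.1 h).1
      rw [← hn] at h'
      nlinarith
    have h4 : ⟪H.b t y, z⟫ ≤ ‖H.b t y‖ * (3 / 2) :=
      (real_inner_le_norm _ _).trans (mul_le_mul_of_nonneg_left hzn (norm_nonneg _))
    have h5 : H.r₀ * ‖z‖ ^ 2 ≤ 9 / 4 * |H.r₀| := by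
      have hz2 : ‖z‖ ^ 2 ≤ 9 / 4 := by nlinarith [norm_nonneg z]
      calc H.r₀ * ‖z‖ ^ 2 ≤ |H.r₀| * ‖z‖ ^ 2 :=
            mul_le_mul_of_nonneg_right (le_abs_self _) (sq_nonneg _)
        _ ≤ |H.r₀| * (9 / 4) := mul_le_mul_of_nonneg_left hz2 (abs_nonneg _)
        _ = _ := by ring
    have h6 : ‖H.b t y‖ ≤ ∑ j, (1 + |H.b t y j| ^ p) := by
      have hs : ‖H.b t y‖ ≤ ∑ j, |H.b t y j| := by
        rw [EuclideanSpace.norm_eq]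
        apply Real.sqrt_le_iff.2
        constructor
        · exact Finset.sum_nonneg fun _ _ => abs_nonneg _
        · simpa using Finset.sum_sq_le_sq_sum_of_nonneg (s := Finset.univ)
            (f := fun j => |H.b t y j|) (fun _ _ => abs_nonneg _)
      refine hs.trans (Finset.sum_le_sum fun j _ => ?_)
      rcases le_total (|H.b t y j|) 1 with h | h
      · have := Real.rpow_nonneg (abs_nonneg (H.b t y j)) p
        linarith
      · have := Real.self_le_rpow_of_one_le h hp1
        linarith
    simp only [hg]
    linarith
  have hsub : ball (x0 - e) (1/2) ⊆ ball (0 : Ed d) (R + 2) := by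
    intro y hy
    rw [mem_ball, dist_eq_norm] at hy ⊢
    have : y - 0 = (y - (x0 - e)) + (x0 - e) := by abel
    rw [this]
    have h1 := norm_add_le (y - (x0 - e)) (x0 - e)
    have h2 := norm_sub_le x0 e
    linarith
  have i1 : v0 * (n / 2) ≤ ∫ y in ball (x0 - e) (1/2), g y := by
    have hc : ∫ y in ball (x0 - e) (1/2), (n / 2 : ℝ) = v0 * (n / 2) := by
      rw [setIntegral_const, smul_eq_mul, hv0, Measure.real, Measure.real,
        Measure.addHaar_ball_center]
    rw [← hc]
    exact setIntegral_mono_on (hIntOn _ continuous_const _ _) (hIntOn _ hgc _ _)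
      measurableSet_ball hpt
  have i2 : ∫ y in ball (x0 - e) (1/2), g y ≤ ∫ y in ball (0 : Ed d) (R + 2), g y :=
    setIntegral_mono_set (hIntOn _ hgc _ _) (Eventually.of_forall hg0)
      (LE.le.eventuallyLE hsub)
  have i3 : ∫ y in ball (0 : Ed d) (R + 2), g y ≤ I := by
    simp only [hg]
    rw [integral_add, integral_const_mul, integral_finsetSum, setIntegral_const, smul_eq_mul, hI]
    · have : ∑ j, ∫ y in ball (0 : Ed d) (R + 2), (1 + |H.b t y j| ^ p) ≤ d * (v1 + Mb) := by
        have h : ∀ j ∈ (Finset.univ : Finset (Fin d)),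
            ∫ y in ball (0 : Ed d) (R + 2), (1 + |H.b t y j| ^ p) ≤ v1 + Mb := by
          intro j _
          rw [integral_add (hIntOn _ continuous_const _ _) (hIntOn _ (hbj j) _ _),
            setIntegral_const, smul_eq_mul, mul_one]
          exact add_le_add le_rfl (hMb t j j).2
        simpa [mul_add] using Finset.sum_le_card_nsmul _ _ _ h
      linarith
    · exact fun j _ => hIntOn _ (continuous_const.add (hbj j)) _ _
    · exact hIntOn _ (continuous_const.mul (continuous_finsetSum _ fun j _ =>
        continuous_const.add (hbj j))) _ _
    · exact hIntOn _ continuous_const _ _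
  have : v0 * (n / 2) ≤ I := i1.trans (i2.trans i3)
  have e1 : 2 / v0 * (v0 * (n / 2)) = n := by field_simp
  rw [← e1]
  exact mul_le_mul_of_nonneg_left this (by positivity)

lemma aux_applyA_sq {d : ℕ} (q : ℝ → Ed d → Matrix (Fin d) (Fin d) ℝ) (b : ℝ → Ed d → Ed d)
    (t : ℝ) (x0 x : Ed d) :
    applyA q b t (fun z => ‖z - x0‖ ^ 2) x = 2 * (∑ i, q t x i i) + 2 * ⟪x - x0, b t x⟫ := by
  have h1 : fderiv ℝ (fun z : Ed d => ‖z - x0‖ ^ 2) = fun z => (2:ℝ) • innerSL ℝ (z - x0) := by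
    ext1 z
    have : HasFDerivAt (fun z : Ed d => ‖z - x0‖ ^ 2) _ z :=
      ((hasFDerivAt_id z).sub_const x0).norm_sq
    rw [this.fderiv]
    ext w
    simp
  have h2 : fderiv ℝ (fun z : Ed d => (2:ℝ) • innerSL ℝ (z - x0)) x = (2:ℝ) • innerSL ℝ := by
    have h := (((innerSL ℝ (E := Ed d)).hasFDerivAt (x := x - x0)).comp x
      ((hasFDerivAt_id x).sub_const x0)).const_smul (2:ℝ)
    exact h.fderiv
  rw [aux_applyA, h1, h2]
  have h3 : ∀ i j : Fin d, ((2:ℝ) • innerSL ℝ (E := Ed d)) (EuclideanSpace.single i 1)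
      (EuclideanSpace.single j 1) = if i = j then 2 else 0 := by
    intro i j
    change (2:ℝ) * inner ℝ (EuclideanSpace.single i (1:ℝ)) (EuclideanSpace.single j (1:ℝ)) = _
    rw [EuclideanSpace.inner_single_left]
    by_cases hij : i = j
    · subst hij; simp
    · simp [hij]
  have h4 : ((2:ℝ) • innerSL ℝ (x - x0)) (b t x) = 2 * ⟪x - x0, b t x⟫ := rfl
  rw [h4, Finset.mul_sum]
  congr 1
  refine Finset.sum_congr rfl fun i _ => ?_
  rw [Finset.sum_eq_single i]
  · rw [h3, if_pos rfl, mul_comm]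
  · intro j _ hj
    rw [h3, if_neg (Ne.symm hj), mul_zero]
  · exact fun h => absurd (Finset.mem_univ i) h


/-- Local Lipschitz bound with exponential decay. -/
lemma aux_loc_lip {d : ℕ} (H : HypothesesR d) (R : ℝ) (hR : 0 < R) (B : ℝ) (hB0 : 0 ≤ B) :
    ∃ lam > (0:ℝ), ∃ C > (0:ℝ), ∀ (s : ℝ) (f : Ed d → ℝ) (u : ℝ → Ed d → ℝ),
      IsBoundedClassicalSolution H.q H.b s f u → (∀ x, |f x| ≤ B) → ∀ t, s + 1 ≤ t →
      ∀ x0 y : Ed d, ‖x0‖ ≤ R → ‖y - x0‖ ≤ 1 →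
      u t x0 - u t y ≤ C * Real.exp (-lam * (t - s)) * ‖x0 - y‖ := by
  obtain ⟨lam, hlam, N, hN, hdec⟩ := aux_decay H
  obtain ⟨β, hβ, c, hc, hd⟩ := aux_doubling H 1 one_pos
  obtain ⟨Cb, hCb⟩ := aux_b_bdd H (R + 1) (by linarith)
  obtain ⟨Mq, hMq⟩ := H.q_bdd (R + 2) (by linarith)
  obtain ⟨m, hm⟩ := ((isCompact_closedBall (0 : Ed d) (R + 2)).bddAbove_image
    (auxV_C2 H).continuous.continuousOn)
  have hm' : ∀ x : Ed d, ‖x‖ ≤ R + 2 → auxV H x ≤ m := fun x hx =>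
    hm (mem_image_of_mem _ (by simpa using hx))
  have hm1 : 1 ≤ m := (auxV_one_le H 0).trans (hm' 0 (by simp; linarith))
  have hψ := aux_psi_pos hβ one_pos
  set ψ1 := 1 - Real.exp (-β * 1) with hψ1
  have hCb0 : 0 ≤ Cb := (norm_nonneg _).trans (hCb 0 0 (by simp; linarith))
  set C' := 2 * (d * |Mq|) + 2 * Cb with hC'
  have hC'0 : 0 ≤ C' := by positivity
  set M' := max ((C' + 2) / c) (1 / ψ1) with hM'
  have hM1 : C' + 2 ≤ M' * c := by
    rw [← div_le_iff₀ hc]; exact le_max_left _ _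
  have hM2 : 1 ≤ M' * ψ1 := by
    rw [← div_le_iff₀ hψ]; exact le_max_right _ _
  have hM0 : 0 < M' := lt_of_lt_of_le (by positivity) (le_max_left _ _)
  refine ⟨lam, hlam, M' * β * (N * (B + 1) * Real.exp lam * (2 * m)), by positivity, ?_⟩
  intro s f u hu hB t ht x0 y0 hx0 hy0
  set A := N * (B + 1) * Real.exp (-lam * (t - 1 - s)) * (2 * m) with hA
  have hA0 : 0 < A := by positivity
  have hw : ∀ τ ∈ Icc (t - 1) t, ∀ x y : Ed d, ‖x‖ ≤ R + 2 → ‖y‖ ≤ R + 2 →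
      u τ x - u τ y ≤ A := by
    intro τ hτ x y hx hy
    refine (hdec B s f u hu hB τ (by linarith [hτ.1]) x y).trans ?_
    have h1 : auxV H x + auxV H y ≤ 2 * m := by linarith [hm' x hx, hm' y hy]
    have h2 : Real.exp (-lam * (τ - s)) ≤ Real.exp (-lam * (t - 1 - s)) := by
      apply Real.exp_le_exp.2
      nlinarith [hτ.1]
    have h3 := auxV_one_le H x
    have h4 := auxV_one_le H y
    rw [hA]
    gcongr
  have hu' := aux_restart hu (t - 1) (by linarith)
  have hv1 : ContDiff ℝ 2 fun z : Ed d => 0 + A * ‖z - x0‖ ^ 2 :=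
    contDiff_const.add (contDiff_const.mul ((contDiff_id.sub contDiff_const).norm_sq ℝ))
  have hsq : ContDiff ℝ 2 fun z : Ed d => ‖z - x0‖ ^ 2 :=
    (contDiff_id.sub contDiff_const).norm_sq ℝ
  have hAv : ∀ (τ : ℝ) (x : Ed d), ‖x - x0‖ ≤ 1 →
      applyA H.q H.b τ (fun z => 0 + A * ‖z - x0‖ ^ 2) x ≤ A * C' := by
    intro τ x hx
    have hxn : ‖x‖ ≤ R + 1 := by
      have := norm_add_le (x - x0) x0
      rw [sub_add_cancel] at this
      linarith
    rw [aux_applyA_sub H.q H.b τ (u := fun _ => (0:ℝ)) contDiff_const hsq A x, aux_applyA_const,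
      zero_add, aux_applyA_sq]
    refine mul_le_mul_of_nonneg_left ?_ hA0.le
    have h1 : ∑ i, H.q τ x i i ≤ d * |Mq| := by
      have h : ∀ i ∈ (Finset.univ : Finset (Fin d)), H.q τ x i i ≤ |Mq| := fun i _ =>
        (le_abs_self _).trans ((hMq τ x (by simp; linarith) i i).trans (le_abs_self _))
      simpa using Finset.sum_le_card_nsmul _ _ _ h
    have h2 : ⟪x - x0, H.b τ x⟫ ≤ Cb := by
      refine (real_inner_le_norm _ _).trans ?_
      have := hCb τ x hxn
      nlinarith [norm_nonneg (x - x0), norm_nonneg (H.b τ x)]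
    linarith
  have hF : ∀ τ x y, auxF 1 β (A * M') (fun z => 0 + A * ‖z - x0‖ ^ 2) (fun _ => 0) A (-A) τ x y =
      A * (M' * (1 - Real.exp (-β * min ‖x - y‖ 1)) + ‖x - x0‖ ^ 2 + (1 - τ)) := by
    intro τ x y; unfold auxF; ring
  have key := aux_compare H 1 β c hβ hd (t - 1) t _ u hu' (closedBall x0 1 ×ˢ closedBall x0 2)
    ((isCompact_closedBall _ _).prod (isCompact_closedBall _ _)) (A * M') 0 (by positivity)
    (fun z => 0 + A * ‖z - x0‖ ^ 2) (fun _ => 0) hv1 contDiff_const A (-A) ?_ t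
    ⟨by linarith, le_rfl⟩ x0 y0 ⟨by simp, by rw [mem_closedBall, dist_eq_norm]; linarith⟩
  · rw [hF] at key
    simp only [neg_zero, zero_mul, Real.exp_zero, one_mul, sub_self, norm_zero] at key
    have e2 : M' * (1 - Real.exp (-β * min ‖x0 - y0‖ 1)) ≤ M' * β * ‖x0 - y0‖ := by
      rw [mul_assoc]
      refine mul_le_mul_of_nonneg_left (aux_psi_le.trans ?_) hM0.le
      exact mul_le_mul_of_nonneg_left (min_le_left _ _) hβ.le
    have e3 : Real.exp (-lam * (t - 1 - s)) = Real.exp lam * Real.exp (-lam * (t - s)) := by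
      rw [← Real.exp_add]; congr 1; ring
    have e4 : A * (M' * (1 - Real.exp (-β * min ‖x0 - y0‖ 1)) + 0 ^ 2 + (1 - (t - (t - 1)))) ≤
        A * (M' * β * ‖x0 - y0‖) := by
      refine mul_le_mul_of_nonneg_left ?_ hA0.le
      linarith
    refine key.trans (e4.trans (le_of_eq ?_))
    rw [hA, e3]; ring
  intro τ hτ x y hxy hlt
  have hx1 : ‖x - x0‖ ≤ 1 := by
    have := hxy.1
    rwa [mem_closedBall, dist_eq_norm] at this
  have hy1 : ‖y - x0‖ ≤ 2 := by
    have := hxy.2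
    rwa [mem_closedBall, dist_eq_norm] at this
  have hxn : ‖x‖ ≤ R + 2 := by
    have := norm_add_le (x - x0) x0
    rw [sub_add_cancel] at this
    linarith
  have hyn : ‖y‖ ≤ R + 2 := by
    have := norm_add_le (y - x0) x0
    rw [sub_add_cancel] at this
    linarith
  have hwA := hw τ hτ x y hxn hyn
  rw [hF] at hlt
  simp only [neg_zero, zero_mul, Real.exp_zero, one_mul] at hlt
  have hψ0 := aux_psi_nonneg hβ.le (le_min (norm_nonneg (x - y)) zero_le_one)
  have hMψ := mul_nonneg hM0.le hψ0
  have ht1 : 0 ≤ 1 - (τ - (t - 1)) := by linarith [hτ.2]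
  have hsq0 := sq_nonneg ‖x - x0‖
  -- the bracket is below one
  have hbr : M' * (1 - Real.exp (-β * min ‖x - y‖ 1)) + ‖x - x0‖ ^ 2 + (1 - (τ - (t - 1))) < 1 := by
    by_contra h
    push Not at h
    have := mul_le_mul_of_nonneg_left h hA0.le
    linarith
  have hr1 : ‖x - y‖ < 1 := by
    by_contra h
    push Not at h
    rw [min_eq_right h, ← hψ1] at hbr
    linarith
  have hx2 : ‖x - x0‖ < 1 := by
    by_contra h
    push Not at h
    nlinarith
  have hy2 : ‖y - x0‖ < 2 := by
    have : y - x0 = (x - x0) - (x - y) := by abel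
    rw [this]
    have := norm_sub_le (x - x0) (x - y)
    linarith
  refine ⟨by linarith, ?_, ?_, fun _ => ?_, fun h => absurd h (not_le.2 hr1)⟩
  · exact prod_mem_nhds (mem_of_superset (isOpen_ball.mem_nhds
      (by rwa [mem_ball, dist_eq_norm])) ball_subset_closedBall)
      (mem_of_superset (isOpen_ball.mem_nhds
      (by rwa [mem_ball, dist_eq_norm])) ball_subset_closedBall)
  · rintro rfl
    have : 0 ≤ A * (M' * (1 - Real.exp (-β * min ‖x - x‖ 1)) + ‖x - x0‖ ^ 2 +
      (1 - (τ - (t - 1)))) := by positivity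
    linarith
  · have h1 := hAv τ x hx1
    rw [aux_applyA_const]
    have h2 := mul_le_mul_of_nonneg_left hM1 hA0.le
    have h3 : -(A * M') * c = -(A * (M' * c)) := by ring
    rw [h3]
    linarith

/-- Local gradient decay. -/
lemma aux_loc_grad {d : ℕ} (H : HypothesesR d) (R : ℝ) (hR : 0 < R) (B : ℝ) (hB0 : 0 ≤ B) :
    ∃ lam > (0:ℝ), ∃ C > (0:ℝ), ∀ (s : ℝ) (f : Ed d → ℝ) (u : ℝ → Ed d → ℝ),
      IsBoundedClassicalSolution H.q H.b s f u → (∀ x, |f x| ≤ B) → ∀ t, s + 1 ≤ t →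
      ∀ x : Ed d, ‖x‖ ≤ R → ‖gradient (u t) x‖ ≤ C * Real.exp (-lam * (t - s)) := by
  obtain ⟨lam, hlam, C, hC, h⟩ := aux_loc_lip H (R + 1) (by linarith) B hB0
  refine ⟨lam, hlam, C, hC, fun s f u hu hB t ht x hx => ?_⟩
  refine aux_grad_of_lip (by positivity) x ?_
  filter_upwards [closedBall_mem_nhds x one_pos] with y hy
  rw [mem_closedBall, dist_eq_norm] at hy
  have hyn : ‖y‖ ≤ R + 1 := by
    have := norm_add_le (y - x) x
    rw [sub_add_cancel] at this
    linarith
  rw [abs_le]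
  constructor
  · have := h s f u hu hB t ht x y (by linarith) hy
    rw [norm_sub_rev] at this
    linarith
  · exact h s f u hu hB t ht y x hyn (by rwa [norm_sub_rev])

/-- Global gradient bound. -/
lemma aux_glob_grad {d : ℕ} (H : HypothesesR d) (B : ℝ) (hB0 : 0 ≤ B) :
    ∃ C > (0:ℝ), ∀ (s : ℝ) (f : Ed d → ℝ) (u : ℝ → Ed d → ℝ),
      IsBoundedClassicalSolution H.q H.b s f u → (∀ x, |f x| ≤ B) → ∀ t, s + 1 ≤ t →
      ∀ x : Ed d, ‖gradient (u t) x‖ ≤ C := by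
  obtain ⟨C, hC, h⟩ := aux_lip H B hB0
  refine ⟨C, hC, fun s f u hu hB t ht x => ?_⟩
  refine aux_grad_of_lip hC.le x (Eventually.of_forall fun y => ?_)
  rw [abs_le]
  constructor
  · have := h s f u hu hB t ht x y
    rw [norm_sub_rev] at this
    linarith
  · exact h s f u hu hB t ht y x


lemma aux_G_zero {d : ℕ} (H : HypothesesR d) (s t : ℝ) (hst : s ≤ t) (f : Ed d → ℝ)
    (hf : ∀ x, f x = 0) (x : Ed d) : H.G t s f x = 0 := by
  have hf0 : f = fun _ => 0 := funext hf
  refine (H.G_unique s f ⟨by rw [hf0]; exact continuous_const, 0, fun y => by simp [hf y]⟩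
    (fun _ _ => 0) ?_ t hst x).symm
  exact
    { cont := continuousOn_const
      bdd := ⟨0, by simp⟩
      smooth_space := fun _ _ => contDiff_const
      pde := fun τ _ x => by
        rw [aux_applyA_const]
        exact hasDerivAt_const _ _
      init := fun x => (hf x).symm }

/-- Measure of the complement of a ball in a strip. -/
lemma aux_nu {d : ℕ} (μ : ℝ → Measure (Ed d)) (hμ : ∀ t, IsProbabilityMeasure (μ t))
    (ν : Measure (ℝ × Ed d))
    (hν : ∀ A : Set ℝ, ∀ B : Set (Ed d), MeasurableSet A → MeasurableSet B →
      ν (A ×ˢ B) = ∫⁻ s in A, μ s B ∂volume) (B : Set (Ed d)) (hB : MeasurableSet B)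
    (ε S t : ℝ) (hε : 0 ≤ ε) (hS : 0 ≤ S) (h : ∀ s, μ s B ≤ ENNReal.ofReal ε) :
    ν (Icc (t - S) (t + S) ×ˢ B) ≤ ENNReal.ofReal (2 * S * ε) := by
  rw [hν _ _ measurableSet_Icc hB]
  calc ∫⁻ s in Icc (t - S) (t + S), μ s B
      ≤ ∫⁻ _ in Icc (t - S) (t + S), ENNReal.ofReal ε := lintegral_mono fun s => h s
    _ = ENNReal.ofReal (2 * S * ε) := by
      rw [setLIntegral_const, Real.volume_Icc, ← ENNReal.ofReal_mul hε]
      congr 1; ring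

/-- Decay of the spatial gradient of the evolution semigroup
`(𝒯(t)h)(s,x) = (G(s,s−t)h(s−t,·))(x)` in `L^p(ℝ^{1+d},ν)`:
`∫ |∇_x 𝒯(t)h|^p dν → 0` as `t → +∞`, for every `p ∈ [2,∞)` and every continuous
compactly supported `h`. -/
theorem gradient_evolution_semigroup_decay (d : ℕ) (H : HypothesesR d)
    (μ : ℝ → Measure (Ed d)) (hsys : IsEvolutionSystemR H μ) (htight : IsTightSystemR μ)
    (ν : Measure (ℝ × Ed d))
    (hν : ∀ A : Set ℝ, ∀ B : Set (Ed d), MeasurableSet A → MeasurableSet B →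
      ν (A ×ˢ B) = ∫⁻ s in A, μ s B ∂volume)
    (p : ℝ) (hp : 2 ≤ p) (h : ℝ × Ed d → ℝ) (hcont : Continuous h)
    (hsupp : HasCompactSupport h) :
    Tendsto (fun t => ∫ z : ℝ × Ed d,
        ‖gradient (fun x => H.G z.1 (z.1 - t) (fun y => h (z.1 - t, y)) x) z.2‖ ^ p ∂ν)
      atTop (𝓝 0) := by
  -- bound and support of `h`
  obtain ⟨B, hB⟩ := hsupp.exists_bound_of_continuous hcont
  have hB0 : 0 ≤ B := (norm_nonneg _).trans (hB (0, 0))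
  obtain ⟨S, hS⟩ := hsupp.isCompact.isBounded.subset_closedBall (0 : ℝ × Ed d)
  set S' := max S 0 with hS'
  have hS0 : 0 ≤ S' := le_max_right _ _
  have hzero : ∀ σ : ℝ, S' < |σ| → ∀ y : Ed d, h (σ, y) = 0 := by
    intro σ hσ y
    by_contra hne
    have hmem := hS (subset_tsupport h hne)
    rw [mem_closedBall, dist_zero_right] at hmem
    have h1 : ‖σ‖ ≤ ‖(σ, y)‖ := norm_fst_le (σ, y)
    have h2 := le_max_left S 0
    rw [Real.norm_eq_abs] at h1
    linarith
  have hCb : ∀ σ : ℝ, IsCb fun y : Ed d => h (σ, y) := fun σ =>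
    ⟨by fun_prop, B, fun y => hB (σ, y)⟩
  have hp0 : 0 < p := by linarith
  obtain ⟨C, hC, hglob⟩ := aux_glob_grad H B hB0
  -- abbreviate the integrand
  set F : ℝ → ℝ × Ed d → ℝ := fun t z =>
    ‖gradient (fun x => H.G z.1 (z.1 - t) (fun y => h (z.1 - t, y)) x) z.2‖ ^ p with hF
  have hF0 : ∀ t z, 0 ≤ F t z := fun t z => Real.rpow_nonneg (norm_nonneg _) _
  have hFout : ∀ t, 0 ≤ t → ∀ z : ℝ × Ed d, z.1 ∉ Icc (t - S') (t + S') → F t z = 0 := by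
    intro t ht z hz
    have habs : S' < |z.1 - t| := by
      by_contra hcon
      push Not at hcon
      rw [abs_le] at hcon
      exact hz ⟨by linarith, by linarith⟩
    have hG : (fun x => H.G z.1 (z.1 - t) (fun y => h (z.1 - t, y)) x) = fun _ => 0 := by
      funext x
      exact aux_G_zero H _ _ (by linarith) _ (hzero _ habs) x
    simp only [hF]
    rw [hG, aux_norm_gradient]
    simp [hp0.ne']
  have hFglob : ∀ t, 1 ≤ t → ∀ z : ℝ × Ed d, F t z ≤ C ^ p := by
    intro t ht z
    refine Real.rpow_le_rpow (norm_nonneg _) ?_ hp0.le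
    exact hglob (z.1 - t) _ (fun τ => H.G τ (z.1 - t) (fun y => h (z.1 - t, y)))
      (H.G_sol _ _ (hCb _)) (fun y => hB (z.1 - t, y)) z.1 (by linarith) z.2
  have hprob := hsys.1
  have hint0 : ∀ t, 0 ≤ ∫ z, F t z ∂ν := fun t => integral_nonneg (hF0 t)
  rw [Metric.tendsto_atTop]
  intro δ hδ
  have hCp : 0 < C ^ p := Real.rpow_pos_of_pos hC p
  -- choose the tightness parameter
  set ε := δ / (4 * (2 * S' + 1) * C ^ p) with hε
  have hε0 : 0 < ε := by positivity
  obtain ⟨R, hR, hRt⟩ := htight ε hε0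
  obtain ⟨lam, hlam, K, hK, hloc⟩ := aux_loc_grad H R hR B hB0
  have hμc : ∀ s, μ s (ball (0 : Ed d) R)ᶜ ≤ ENNReal.ofReal ε := by
    intro s
    haveI := hprob s
    rw [prob_compl_eq_one_sub measurableSet_ball]
    refine tsub_le_iff_right.2 ?_
    calc (1 : ENNReal) = ENNReal.ofReal (ε + (1 - ε)) := by simp
      _ ≤ ENNReal.ofReal ε + ENNReal.ofReal (1 - ε) := ENNReal.ofReal_add_le
      _ ≤ _ := add_le_add le_rfl (hRt s)
  have hμ1 : ∀ s, μ s univ ≤ ENNReal.ofReal 1 := by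
    intro s
    haveI := hprob s
    simp
  have hdecay : Tendsto (fun t : ℝ => (K * Real.exp (-lam * t)) ^ p) atTop (𝓝 0) := by
    have h1 : Tendsto (fun t : ℝ => K * Real.exp (-lam * t)) atTop (𝓝 (K * 0)) := by
      refine Tendsto.const_mul K (Real.tendsto_exp_atBot.comp ?_)
      exact tendsto_id.const_mul_atTop_of_neg (by linarith)
    have h2 := h1.rpow_const (p := p) (Or.inr hp0.le)
    rwa [mul_zero, Real.zero_rpow hp0.ne'] at h2
  have hev : ∀ᶠ t : ℝ in atTop, (K * Real.exp (-lam * t)) ^ p < δ / (4 * (2 * S' + 1)) :=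
    hdecay.eventually_lt_const (by positivity)
  obtain ⟨T, hT⟩ := eventually_atTop.1 (hev.and (eventually_ge_atTop 1))
  refine ⟨T, fun t ht => ?_⟩
  obtain ⟨hsmall, ht1⟩ := hT t ht
  set δ1 := (K * Real.exp (-lam * t)) ^ p with hδ1
  have hδ10 : 0 ≤ δ1 := Real.rpow_nonneg (by positivity) _
  rw [dist_zero_right, Real.norm_eq_abs, abs_of_nonneg (hint0 t)]
  set I := Icc (t - S') (t + S') with hI
  set E1 := I ×ˢ (ball (0 : Ed d) R)ᶜ with hE1
  set E2 := I ×ˢ (univ : Set (Ed d)) with hE2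
  have hmE1 : MeasurableSet E1 := measurableSet_Icc.prod measurableSet_ball.compl
  have hmE2 : MeasurableSet E2 := measurableSet_Icc.prod MeasurableSet.univ
  have hn1 : ν E1 ≤ ENNReal.ofReal (2 * S' * ε) :=
    aux_nu μ hprob ν hν _ measurableSet_ball.compl ε S' t hε0.le hS0 hμc
  have hn2 : ν E2 ≤ ENNReal.ofReal (2 * S' * 1) :=
    aux_nu μ hprob ν hν _ MeasurableSet.univ 1 S' t zero_le_one hS0 hμ1
  have hi1 : Integrable (E1.indicator fun _ => C ^ p) ν :=
    (integrable_indicator_iff hmE1).2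
      (integrableOn_const (hn1.trans_lt ENNReal.ofReal_lt_top).ne)
  have hi2 : Integrable (E2.indicator fun _ => δ1) ν :=
    (integrable_indicator_iff hmE2).2
      (integrableOn_const (hn2.trans_lt ENNReal.ofReal_lt_top).ne)
  have hle : ∫ z, F t z ∂ν ≤
      ∫ z, (E1.indicator (fun _ => C ^ p) z + E2.indicator (fun _ => δ1) z) ∂ν := by
    refine integral_mono_of_nonneg (Eventually.of_forall (hF0 t)) (hi1.add hi2)
      (Eventually.of_forall fun z => ?_)
    by_cases hz : z.1 ∈ I
    · have hz2 : z ∈ E2 := ⟨hz, mem_univ _⟩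
      simp only [indicator_of_mem hz2]
      by_cases hzb : z.2 ∈ ball (0 : Ed d) R
      · have hz1 : z ∉ E1 := fun hh => hh.2 hzb
        rw [indicator_of_notMem hz1, zero_add]
        refine Real.rpow_le_rpow (norm_nonneg _) ?_ hp0.le
        have := hloc (z.1 - t) _ (fun τ => H.G τ (z.1 - t) (fun y => h (z.1 - t, y)))
          (H.G_sol _ _ (hCb _)) (fun y => hB (z.1 - t, y)) z.1 (by linarith) z.2
          (by simpa using (mem_ball.1 hzb).le)
        rwa [sub_sub_cancel] at this
      · have hz1 : z ∈ E1 := ⟨hz, hzb⟩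
        rw [indicator_of_mem hz1]
        have := hFglob t ht1 z
        linarith
    · rw [hFout t (by linarith) z hz]
      exact add_nonneg (indicator_nonneg (fun _ _ => hCp.le) _)
        (indicator_nonneg (fun _ _ => hδ10) _)
  rw [integral_add hi1 hi2, integral_indicator hmE1, integral_indicator hmE2, setIntegral_const,
    setIntegral_const, smul_eq_mul, smul_eq_mul] at hle
  have r1 : ν.real E1 ≤ 2 * S' * ε := ENNReal.toReal_le_of_le_ofReal (by positivity) hn1
  have r2 : ν.real E2 ≤ 2 * S' * 1 := ENNReal.toReal_le_of_le_ofReal (by positivity) hn2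
  have q1 : ν.real E1 * C ^ p ≤ δ / 4 := by
    calc ν.real E1 * C ^ p ≤ (2 * S' + 1) * ε * C ^ p := by
          refine mul_le_mul_of_nonneg_right (r1.trans ?_) hCp.le
          nlinarith
      _ = δ / 4 := by rw [hε]; field_simp
  have q2 : ν.real E2 * δ1 ≤ δ / 4 := by
    calc ν.real E2 * δ1 ≤ (2 * S' + 1) * (δ / (4 * (2 * S' + 1))) := by
          refine mul_le_mul (by linarith) hsmall.le hδ10 (by positivity)
      _ = δ / 4 := by field_simp
  linarith
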